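/- Assume that either k = 𝔽_𝔭 or φ is ordinary, and that End_k(φ) = A[π]. Then the map I ↦ I*φ induces a bijection from the set of linear equivalence classes of nonzero ideals of A[π] onto the set of isomorphism classes of Drinfeld modules over k isogenous to φ. -/

import Mathlib

/- Framework: Drinfeld modules over a finite A-field `k`, realized concretely.
`k{τ}` is the subring of additive endomorphisms of an algebraic closure of `k`
generated by the `q`-power Frobenius `τ` and multiplications by elements of `k`. -/

open Polynomial

noncomputable section

namespace Drinfeld

variable (p m : ℕ) [Fact p.Prime]
variable (Fq k : Type) [Field Fq] [Fintype Fq] [Field k] [Fintype k] [CharP k p]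

/-- A fixed algebraic closure of `k`. -/
abbrev Kb := AlgebraicClosure k

variable (hFq : Fintype.card Fq = p ^ m)

/-- The `q`-power Frobenius `τ : x ↦ x^q` as an additive endomorphism of `Kb k`. -/
def tau : AddMonoid.End (Kb k) where
  toFun x := x ^ Fintype.card Fq
  map_zero' := zero_pow Fintype.card_ne_zero
  map_add' x y := by
    haveI : CharP (Kb k) p :=
      charP_of_injective_algebraMap (algebraMap k (Kb k)).injective p
    simp only [hFq]
    exact add_pow_char_pow x y p m

/-- Multiplication by `c ∈ k` as an additive endomorphism of `Kb k`. -/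
def ml (c : k) : AddMonoid.End (Kb k) :=
  AddMonoidHom.mulLeft (algebraMap k (Kb k) c)

/-- The twisted polynomial ring `k{τ}`. -/
def skewPoly : Subring (AddMonoid.End (Kb k)) :=
  Subring.closure (insert (tau p m Fq k hFq) (Set.range (ml k)))

/-- The additive endomorphism `Σᵢ cᵢ ∘ τ^i` attached to a finitely supported
family of coefficients `c : ℕ →₀ k`. -/
def ofCoeffs (c : ℕ →₀ k) : AddMonoid.End (Kb k) :=
  c.sum fun i a => ml k a * tau p m Fq k hFq ^ i

/-- A Drinfeld module of rank `r` over the `A`-field `(k, γ)`: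
a ring homomorphism `φ : A = Fq[T] → k{τ}` with
`φ_a = γ(a) + g₁(a) τ + ⋯ + g_{r·deg a}(a) τ^{r·deg a}` and `g_{r · deg a}(a) ≠ 0`. -/
structure DrinfeldModule (γ : Polynomial Fq →+* k) (r : ℕ) : Type where
  toRingHom : Polynomial Fq →+* AddMonoid.End (Kb k)
  coeffs : Polynomial Fq → ℕ →₀ k
  eq_ofCoeffs : ∀ a, toRingHom a = ofCoeffs p m Fq k hFq (coeffs a)
  coeff_zero : ∀ a, coeffs a 0 = γ a
  coeff_top : ∀ a, a ≠ 0 → coeffs a (r * a.natDegree) ≠ 0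
  coeff_eq_zero : ∀ a i, r * a.natDegree < i → coeffs a i = 0

variable {γ : Polynomial Fq →+* k} {r : ℕ}

/-- The endomorphism ring `End_k(φ)`: the centralizer of `φ(A)` in `k{τ}`. -/
def EndRing (φ : DrinfeldModule p m Fq k hFq γ r) : Subring (AddMonoid.End (Kb k)) :=
  skewPoly p m Fq k hFq ⊓ Subring.centralizer (Set.range ⇑φ.toRingHom)

/-- `u` is an isogeny `φ → ψ`: a nonzero element of `k{τ}` with `u φ_a = ψ_a u`. -/
def IsIsogeny (φ ψ : DrinfeldModule p m Fq k hFq γ r) (u : AddMonoid.End (Kb k)) : Prop :=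
  u ≠ 0 ∧ u ∈ skewPoly p m Fq k hFq ∧ ∀ a, u * φ.toRingHom a = ψ.toRingHom a * u

/-- Two Drinfeld modules are isomorphic when some isogeny between them lies in `k^×`. -/
def Isomorphic (φ ψ : DrinfeldModule p m Fq k hFq γ r) : Prop :=
  ∃ c : k, c ≠ 0 ∧ ∀ a, ml k c * φ.toRingHom a = ψ.toRingHom a * ml k c

/-- The left ideal `k{τ}·s` of `k{τ}` generated by a subset `s`. -/
def leftSpan (s : Set (AddMonoid.End (Kb k))) : AddSubgroup (AddMonoid.End (Kb k)) :=
  AddSubgroup.closure {y | ∃ w ∈ skewPoly p m Fq k hFq, ∃ x ∈ s, y = w * x}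

/-- `u` generates the left ideal `k{τ}·s` of `k{τ}`: `k{τ}s = k{τ}u`.
(Such a `u = u_I` exists by the right division algorithm in `k{τ}`.) -/
def IsIdealGen (s : Set (AddMonoid.End (Kb k))) (u : AddMonoid.End (Kb k)) : Prop :=
  u ∈ skewPoly p m Fq k hFq ∧
    (leftSpan p m Fq k hFq s : Set (AddMonoid.End (Kb k))) =
      {y | ∃ w ∈ skewPoly p m Fq k hFq, y = w * u}

/-- `I` is an ideal of the (commutative) subring `E` of `k{τ}`. -/
def IsIdealOf (E : Subring (AddMonoid.End (Kb k))) (I : Set (AddMonoid.End (Kb k))) : Prop :=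
  I ⊆ E ∧ (0 : AddMonoid.End (Kb k)) ∈ I ∧
    (∀ x ∈ I, ∀ y ∈ I, x + y ∈ I) ∧ (∀ x ∈ I, -x ∈ I) ∧
    (∀ e ∈ E, ∀ x ∈ I, e * x ∈ I) ∧ (∀ e ∈ E, ∀ x ∈ I, x * e ∈ I)

/-- Membership in `D = End_k(φ) ⊗_A F = Frac(End_k(φ))` for an element of `k{τ}`:
`x ∈ D` iff `x·φ_a ∈ End_k(φ)` for some nonzero `a ∈ A`, i.e. `x = e/φ_a`. -/
def MemD (φ : DrinfeldModule p m Fq k hFq γ r) (x : AddMonoid.End (Kb k)) : Prop :=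
  ∃ a : Polynomial Fq, a ≠ 0 ∧ x * φ.toRingHom a ∈ EndRing p m Fq k hFq φ

/-- `I` is a kernel ideal: `(k{τ}I) ∩ D = I`. -/
def IsKernelIdeal (φ : DrinfeldModule p m Fq k hFq γ r)
    (I : Set (AddMonoid.End (Kb k))) : Prop :=
  {x | x ∈ leftSpan p m Fq k hFq I ∧ MemD p m Fq k hFq φ x} = I

/-- The subring `A[π] = φ(A)[π]` of `k{τ}`, where `π = τ^n` is the Frobenius of `k`. -/
def ApirOp (n : ℕ) (φ : DrinfeldModule p m Fq k hFq γ r) :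
    Subring (AddMonoid.End (Kb k)) :=
  Subring.closure (insert (tau p m Fq k hFq ^ n) (Set.range ⇑φ.toRingHom))

/-- `φ` has height `H` (relative to the monic generator `P` of `𝔭 = ker γ`):
the smallest `τ`-degree of a nonzero term of `φ_P` equals `H · deg P`, i.e. `φ_P` is
right-divisible by `τ^{H·deg P}` but not by `τ^{H·deg P + 1}`. -/
def HasHeight (φ : DrinfeldModule p m Fq k hFq γ r) (P : Polynomial Fq) (H : ℕ) : Prop :=
  (∃ u ∈ skewPoly p m Fq k hFq,
      φ.toRingHom P = u * tau p m Fq k hFq ^ (H * P.natDegree)) ∧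
    ¬∃ u ∈ skewPoly p m Fq k hFq,
      φ.toRingHom P = u * tau p m Fq k hFq ^ (H * P.natDegree + 1)

/-- `I = J·u` for some nonzero `u ∈ D = Frac(E)`, written as `u = e/φ_a` with `e ∈ E`,
`a ∈ A` both nonzero; equivalently `I·φ_a = J·e`. -/
def LinEquiv (φ : DrinfeldModule p m Fq k hFq γ r) (E : Subring (AddMonoid.End (Kb k)))
    (I J : Set (AddMonoid.End (Kb k))) : Prop :=
  ∃ e ∈ E, e ≠ 0 ∧ ∃ a : Polynomial Fq, a ≠ 0 ∧
    (fun x => x * φ.toRingHom a) '' I = (fun y => y * e) '' J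

/-- The additive polynomial `u(X) ∈ k[X]` attached to `u ∈ k{τ}` (the unique polynomial
inducing `u` on the algebraic closure, if it exists; junk value `0` otherwise). -/
def toPoly (u : AddMonoid.End (Kb k)) : Polynomial k :=
  letI := Classical.propDecidable (∃ P : Polynomial k, ∀ x : Kb k, Polynomial.aeval x P = u x)
  if h : ∃ P : Polynomial k, ∀ x : Kb k, Polynomial.aeval x P = u x then h.choose else 0

end Drinfeld


namespace Drinfeld

section PowerBases

/-- An algebra with a power basis carries a perfect symmetric form `(x, y) ↦ l (x * y)`. -/
theorem exists_perfect_functional {Z E : Type*} [CommRing Z] [CommRing E] [Nontrivial E]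
    [Algebra Z E] (pb : PowerBasis Z E) :
    ∃ l : E →ₗ[Z] Z, (∀ b, (∀ e, l (b * e) = 0) → b = 0) ∧
      ∀ g : E →ₗ[Z] Z, ∃ b, ∀ e, g e = l (b * e) := by
  have hs : 0 < pb.dim := pb.dim_pos
  let l : E →ₗ[Z] Z := pb.basis.coord ⟨pb.dim - 1, by omega⟩
  have hl0 : ∀ i, i < pb.dim - 1 → l (pb.gen ^ i) = 0 := by
    intro i hi
    have : pb.gen ^ i = pb.basis ⟨i, by omega⟩ := by simp
    rw [this, Module.Basis.coord_apply, Module.Basis.repr_self, Finsupp.single_apply, if_neg]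
    simp only [Fin.mk.injEq]
    omega
  have hl1 : l (pb.gen ^ (pb.dim - 1)) = 1 := by
    have : pb.gen ^ (pb.dim - 1) = pb.basis ⟨pb.dim - 1, by omega⟩ := by simp
    rw [this, Module.Basis.coord_apply, Module.Basis.repr_self, Finsupp.single_apply, if_pos rfl]
  have hsurj : ∀ g : E →ₗ[Z] Z, ∃ b, ∀ e, g e = l (b * e) := by
    intro g
    have key : ∀ j ≤ pb.dim, ∃ b, ∀ i < j, g (pb.gen ^ i) = l (b * pb.gen ^ i) := by
      intro j
      induction j with
      | zero => exact fun _ => ⟨0, by simp⟩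
      | succ j ih =>
        intro hj
        obtain ⟨b, hb⟩ := ih (by omega)
        refine ⟨b + (g (pb.gen ^ j) - l (b * pb.gen ^ j)) • pb.gen ^ (pb.dim - 1 - j), ?_⟩
        intro i hi
        rw [add_mul, map_add, smul_mul_assoc, map_smul, ← pow_add]
        rcases Nat.lt_succ_iff_lt_or_eq.mp hi with h | rfl
        · rw [hl0 _ (by omega), hb i h]; simp
        · rw [Nat.sub_add_cancel (by omega), hl1]; simp
    obtain ⟨b, hb⟩ := key _ le_rfl
    refine ⟨b, fun e => ?_⟩
    have : g = l ∘ₗ LinearMap.mulLeft Z b := by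
      refine pb.basis.ext fun i => ?_
      simpa using hb i i.2
    rw [this]; simp
  refine ⟨l, ?_, hsurj⟩
  let f : E →ₗ[Z] Module.Dual Z E := LinearMap.llcomp Z E E Z l ∘ₗ LinearMap.mul Z E
  have hf : ∀ b e, f b e = l (b * e) := fun b e => rfl
  have fs : Function.Surjective f := fun g => by
    obtain ⟨b, hb⟩ := hsurj g
    exact ⟨b, by ext e; rw [hf, hb]⟩
  have := Module.Finite.of_basis pb.basis
  have finj : Function.Injective (pb.basis.toDualEquiv.symm.toLinearMap ∘ₗ f) :=
    OrzechProperty.injective_of_surjective_endomorphism _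
      (pb.basis.toDualEquiv.symm.surjective.comp fs)
  intro b hb
  apply finj
  have : f b = 0 := by ext e; rw [hf, hb]; rfl
  simp [this]

/-- Over a finite-dimensional Frobenius algebra, a faithful module of dimension at most that of
the algebra has the double annihilator property. -/
theorem mem_of_annihilator_le {F B V : Type*} [Field F] [CommRing B] [Algebra F B]
    [FiniteDimensional F B] [AddCommGroup V] [Module F V] [FiniteDimensional F V] [Module B V]
    [IsScalarTower F B V] (ε : B →ₗ[F] F) (hε : ∀ b, (∀ c, ε (b * c) = 0) → b = 0)
    (hfaith : ∀ b : B, (∀ v : V, b • v = 0) → b = 0)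
    (hdim : Module.finrank F V ≤ Module.finrank F B)
    (G : Submodule B V) (v : V) (hv : ∀ b : B, (∀ g ∈ G, b • g = 0) → b • v = 0) : v ∈ G := by
  have : IsArtinianRing B := IsArtinianRing.of_finite F B
  -- every functional on `B` comes from `ε`
  let f : B →ₗ[F] Module.Dual F B := LinearMap.llcomp F B B F ε ∘ₗ LinearMap.mul F B
  have hf : ∀ b e, f b e = ε (b * e) := fun b e => rfl
  have finj : Function.Injective f := by
    rw [injective_iff_map_eq_zero]
    exact fun b hb => hε b fun c => by rw [← hf, hb]; rfl
  have fsurj : Function.Surjective f :=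
    (LinearMap.injective_iff_surjective_of_finrank_eq_finrank
      (Subspace.dual_finrank_eq).symm).mp finj
  have hrep : ∀ (l : Module.Dual F V) (w : V), ∃ h : B, ∀ b, ε (h * b) = l (b • w) := by
    intro l w
    obtain ⟨h, hh⟩ := fsurj (l ∘ₗ (LinearMap.toSpanSingleton B V w).restrictScalars F)
    exact ⟨h, fun b => by rw [← hf, hh]; rfl⟩
  choose h hh using hrep
  have hloc : ∀ M : MaximalSpectrum B, ∃ l w, h l w ∉ M.asIdeal := by
    intro M
    by_contra! hcon
    obtain ⟨g, hg0, hg⟩ : ∃ g : Module.Dual F B, g ≠ 0 ∧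
        (M.asIdeal.restrictScalars F) ≤ LinearMap.ker g := by
      apply Submodule.exists_le_ker_of_lt_top
      rw [lt_top_iff_ne_top]
      intro htop
      apply M.isMaximal.ne_top
      rw [Ideal.eq_top_iff_one]
      have : (1 : B) ∈ M.asIdeal.restrictScalars F := htop ▸ Submodule.mem_top
      exact this
    obtain ⟨c, rfl⟩ := fsurj g
    apply hg0
    have hc : c = 0 := by
      apply hfaith
      intro w
      rw [← Module.forall_dual_apply_eq_zero_iff F]
      intro l
      rw [← hh, mul_comm, ← hf]
      have : h l w ∈ M.asIdeal.restrictScalars F := hcon l w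
      exact hg this
    rw [hc, map_zero]
  choose l w hlw using hloc
  have := Fintype.ofFinite (MaximalSpectrum B)
  classical
  have hcrt : ∀ i : MaximalSpectrum B, ∃ e : B, e - 1 ∈ i.asIdeal ∧
      ∀ j, j ≠ i → e ∈ j.asIdeal := by
    intro i
    obtain ⟨e, he⟩ := Ideal.pi_quotient_surjective (I := fun j : MaximalSpectrum B => j.asIdeal)
      (fun a b hab => Ideal.isCoprime_of_isMaximal (fun hh => hab (MaximalSpectrum.ext hh)))
      (fun j => if j = i then 1 else 0)
    refine ⟨e, ?_, fun j hj => ?_⟩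
    · have := he i
      rw [if_pos rfl] at this
      exact Ideal.Quotient.eq.mp (this.trans (map_one _).symm)
    · have := he j
      rw [if_neg hj] at this
      exact Ideal.Quotient.eq_zero_iff_mem.mp this
  choose e he1 he0 using hcrt
  -- glue the local choices
  let lm : B → Module.Dual F V → Module.Dual F V := fun b l => l ∘ₗ (Module.toModuleEnd F (S := B) V b)
  have hlm : ∀ b l v, lm b l v = l (b • v) := fun _ _ _ => rfl
  let L : Module.Dual F V := ∑ i, lm (e i) (l i)
  let W : V := ∑ j, e j • w j
  have hH : h L W = ∑ i, ∑ j, e i * e j * h (l i) (w j) := by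
    apply finj
    ext b
    rw [hf, hh, hf, Finset.sum_mul, map_sum]
    simp only [L, LinearMap.sum_apply, hlm, W]
    refine Finset.sum_congr rfl fun i _ => ?_
    rw [Finset.smul_sum, Finset.smul_sum, map_sum, Finset.sum_mul, map_sum]
    refine Finset.sum_congr rfl fun j _ => ?_
    rw [show e i * e j * h (l i) (w j) * b = h (l i) (w j) * (e i * (b * e j)) by ring, hh]
    simp only [mul_smul]
  have hunit : IsUnit (h L W) := by
    by_contra hnu
    obtain ⟨M, hM, hmem⟩ := exists_max_ideal_of_mem_nonunits hnu
    let i : MaximalSpectrum B := ⟨M, hM⟩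
    have hz : ∀ j, j ≠ i → Ideal.Quotient.mk M (e j) = 0 := fun j hj =>
      Ideal.Quotient.eq_zero_iff_mem.mpr (he0 j i hj.symm)
    have ho : Ideal.Quotient.mk M (e i) = 1 := by
      rw [← map_one (Ideal.Quotient.mk M)]; exact Ideal.Quotient.eq.mpr (he1 i)
    have h2 : Ideal.Quotient.mk M (h L W) = Ideal.Quotient.mk M (h (l i) (w i)) := by
      rw [hH, map_sum, Finset.sum_eq_single i, map_sum, Finset.sum_eq_single i]
      · simp [ho]
      · intro j _ hj; simp [hz j hj]
      · simp
      · intro j _ hj; simp [hz j hj]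
      · simp
    rw [Ideal.Quotient.eq_zero_iff_mem.mpr hmem, eq_comm, Ideal.Quotient.eq_zero_iff_mem] at h2
    exact hlw i h2
  let Λ : B →ₗ[F] Module.Dual F V :=
    { toFun := fun b => lm b L
      map_add' := fun a b => by ext v; simp [hlm, add_smul]
      map_smul' := fun a b => by ext v; simp [hlm] }
  have hΛ : ∀ b v, Λ b v = L (b • v) := fun _ _ => rfl
  have Λinj : Function.Injective Λ := by
    rw [injective_iff_map_eq_zero]
    intro b hb
    apply hunit.mul_right_eq_zero.mp
    apply hε
    intro c
    rw [mul_assoc, hh, mul_smul, ← hΛ, hb]; rfl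
  have Λsurj : Function.Surjective Λ := by
    refine (LinearMap.injective_iff_surjective_of_finrank_eq_finrank ?_).mp Λinj
    have := LinearMap.finrank_le_finrank_of_injective Λinj
    rw [Subspace.dual_finrank_eq] at *
    omega
  by_contra hvG
  obtain ⟨θ, hθv, hθG⟩ := Submodule.exists_le_ker_of_notMem (p := G.restrictScalars F) (v := v) hvG
  obtain ⟨b, rfl⟩ := Λsurj θ
  apply hθv
  rw [hΛ, hv b, map_zero]
  intro g hg
  rw [← Module.forall_dual_apply_eq_zero_iff F]
  intro θ'
  obtain ⟨c, rfl⟩ := Λsurj θ'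
  rw [hΛ, smul_comm, ← hΛ]
  exact hθG (G.smul_mem c hg)

theorem mem_of_annihilator_le_of_powerBasis {F E V : Type*} [Field F] [CommRing E] [Nontrivial E]
    [Algebra F E] [Algebra F[X] E] [IsScalarTower F F[X] E] (pb : PowerBasis F[X] E)
    [AddCommGroup V] [Module F V] [FiniteDimensional F V] [Module E V] [IsScalarTower F E V]
    (z : F[X]) (hz : z.Monic)
    (hann : ∀ e : E, (∀ v : V, e • v = 0) ↔ algebraMap F[X] E z ∣ e)
    (hdim : Module.finrank F V ≤ pb.dim * z.natDegree)
    (G : Submodule E V) (v : V) (hv : ∀ e : E, (∀ g ∈ G, e • g = 0) → e • v = 0) : v ∈ G := by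
  obtain ⟨l, hl0, hl⟩ := exists_perfect_functional pb
  set ζ := algebraMap F[X] E z with hζ
  let J : Ideal E := Ideal.span {ζ}
  have hJ : ∀ e, e ∈ J ↔ ζ ∣ e := fun e => Ideal.mem_span_singleton
  have htor : Module.IsTorsionBySet E V J := fun v a => (hann a).mpr ((hJ a).mp a.2) v
  let _ : Module (E ⧸ J) V := htor.module
  have hsm : ∀ (e : E) (v : V), (Ideal.Quotient.mk J e) • v = e • v := fun e v => htor.mk_smul e v
  have : IsScalarTower F (E ⧸ J) V := ⟨fun a b v => by
    obtain ⟨b, rfl⟩ := Ideal.Quotient.mk_surjective b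
    rw [show a • Ideal.Quotient.mk J b = Ideal.Quotient.mk J (a • b) from rfl, hsm, hsm,
      smul_assoc]⟩
  let Φ : E →ₗ[F] (Fin pb.dim → AdjoinRoot z) :=
    LinearMap.pi fun i => (AdjoinRoot.mkₐ z).toLinearMap ∘ₗ
      (pb.basis.coord i).restrictScalars F
  have hΦ : ∀ e i, Φ e i = AdjoinRoot.mk z (pb.basis.repr e i) := fun _ _ => rfl
  have hΦs : Function.Surjective Φ := by
    intro t
    choose g hg using fun i => AdjoinRoot.mk_surjective (t i)
    refine ⟨pb.basis.equivFun.symm g, funext fun i => ?_⟩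
    rw [hΦ, ← hg, ← Module.Basis.equivFun_apply, LinearEquiv.apply_symm_apply]
  have hker : LinearMap.ker Φ = J.restrictScalars F := by
    ext e
    rw [LinearMap.mem_ker, Submodule.restrictScalars_mem, hJ]
    constructor
    · intro he
      have : ∀ i, z ∣ pb.basis.repr e i := fun i => by
        rw [← AdjoinRoot.mk_eq_zero, ← hΦ, he]; rfl
      choose c hc using this
      refine ⟨∑ i, c i • pb.basis i, ?_⟩
      conv_lhs => rw [← pb.basis.sum_repr e]
      rw [Finset.mul_sum]
      refine Finset.sum_congr rfl fun i _ => ?_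
      rw [hc, mul_smul, Algebra.smul_def]
    · rintro ⟨c, rfl⟩
      ext i
      rw [hΦ, hζ, ← Algebra.smul_def, map_smul]
      simp
  let eqv : (E ⧸ J) ≃ₗ[F] (Fin pb.dim → AdjoinRoot z) :=
    ((Submodule.Quotient.restrictScalarsEquiv F J).symm.trans
      (Submodule.quotEquivOfEq _ _ hker.symm)).trans (Φ.quotKerEquivOfSurjective hΦs)
  have := hz.finite_adjoinRoot
  have : FiniteDimensional F (E ⧸ J) := Module.Finite.equiv eqv.symm
  have hfr : Module.finrank F (E ⧸ J) = pb.dim * z.natDegree := by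
    rw [eqv.finrank_eq, Module.finrank_pi_fintype, Finset.sum_const, Finset.card_univ,
      Fintype.card_fin, smul_eq_mul, (AdjoinRoot.powerBasis hz.ne_zero).finrank,
      AdjoinRoot.powerBasis_dim]
  -- the form on the quotient
  let ε₀ : E →ₗ[F] F := Polynomial.lcoeff F (z.natDegree - 1) ∘ₗ
    Polynomial.modByMonicHom z ∘ₗ l.restrictScalars F
  have hε₀ : ∀ e, ε₀ e = (l e %ₘ z).coeff (z.natDegree - 1) := fun _ => rfl
  have hε₀J : J.restrictScalars F ≤ LinearMap.ker ε₀ := by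
    intro e he
    rw [Submodule.restrictScalars_mem, hJ] at he
    obtain ⟨c, rfl⟩ := he
    rw [LinearMap.mem_ker, hε₀, hζ, ← Algebra.smul_def, map_smul, smul_eq_mul,
      (Polynomial.modByMonic_eq_zero_iff_dvd hz).mpr (dvd_mul_right _ _), coeff_zero]
  let ε : (E ⧸ J) →ₗ[F] F := (J.restrictScalars F).liftQ ε₀ hε₀J ∘ₗ
    (Submodule.Quotient.restrictScalarsEquiv F J).symm.toLinearMap
  have hε : ∀ e, ε (Ideal.Quotient.mk J e) = (l e %ₘ z).coeff (z.natDegree - 1) := fun _ => rfl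
  refine mem_of_annihilator_le (B := E ⧸ J) ε ?_ ?_ (by rw [hfr]; exact hdim)
    { G with smul_mem' := ?_ } v ?_
  · intro b hb
    obtain ⟨e, rfl⟩ := Ideal.Quotient.mk_surjective b
    have hdvd : ∀ e', z ∣ l (e * e') := by
      intro e'
      by_contra hnd
      rw [← Polynomial.modByMonic_eq_zero_iff_dvd hz] at hnd
      set c := l (e * e') %ₘ z with hc
      have hcd : c.natDegree < z.natDegree := by
        apply Polynomial.natDegree_modByMonic_lt _ hz
        rintro rfl
        exact hnd (Polynomial.modByMonic_one _)
      have h1 := hb (Ideal.Quotient.mk J ((X ^ (z.natDegree - 1 - c.natDegree) : F[X]) • e'))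
      rw [← map_mul, hε, mul_smul_comm, map_smul, smul_eq_mul] at h1
      have h2 : (X ^ (z.natDegree - 1 - c.natDegree) * l (e * e')) %ₘ z =
          X ^ (z.natDegree - 1 - c.natDegree) * c := by
        rw [← (Polynomial.modByMonic_eq_self_iff hz (p := X ^ _ * c)).mpr]
        · apply Polynomial.modByMonic_eq_of_dvd_sub hz
          rw [← mul_sub]
          apply Dvd.dvd.mul_left
          rw [← neg_sub, dvd_neg]
          exact Polynomial.dvd_modByMonic_sub _ _
        · apply Polynomial.degree_lt_degree
          rw [Polynomial.natDegree_X_pow_mul _ hnd]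
          omega
      rw [h2, Polynomial.coeff_X_pow_mul', if_pos (by omega),
        show z.natDegree - 1 - (z.natDegree - 1 - c.natDegree) = c.natDegree by omega] at h1
      exact hnd (Polynomial.leadingCoeff_eq_zero.mp h1)
    choose h hh using hdvd
    let H : E →ₗ[F[X]] F[X] :=
      { toFun := h
        map_add' := fun a b => mul_left_cancel₀ hz.ne_zero (by
          rw [mul_add, ← hh, ← hh, ← hh, mul_add, map_add])
        map_smul' := fun a b => mul_left_cancel₀ hz.ne_zero (by
          rw [RingHom.id_apply, smul_eq_mul, mul_left_comm, ← hh, ← hh, mul_smul_comm, map_smul,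
            smul_eq_mul]) }
    obtain ⟨b, hb⟩ := hl H
    rw [Ideal.Quotient.eq_zero_iff_mem, hJ]
    refine ⟨b, sub_eq_zero.mp (hl0 _ fun e' => ?_)⟩
    have h3 : l (ζ * b * e') = z * h e' := by
      rw [show h e' = l (b * e') from hb e', hζ, mul_assoc, ← Algebra.smul_def, map_smul,
        smul_eq_mul]
    rw [sub_mul, map_sub, hh, h3, sub_self]
  · intro b hb
    obtain ⟨e, rfl⟩ := Ideal.Quotient.mk_surjective b
    rw [Ideal.Quotient.eq_zero_iff_mem, hJ, ← hann]
    exact fun v => by rw [← hsm, hb]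
  · intro b g hg
    obtain ⟨e, rfl⟩ := Ideal.Quotient.mk_surjective b
    rw [hsm]
    exact G.smul_mem e hg
  · intro b hb
    obtain ⟨e, rfl⟩ := Ideal.Quotient.mk_surjective b
    rw [hsm]
    exact hv e fun g hg => by rw [← hsm]; exact hb g hg

/-- Extending the perfect form on `E` to `R` produces an `E`-linear retraction of `ι`, so ideals
of `E` are contracted from `R`. -/
theorem mem_ideal_of_mem_closure {Z E R : Type*} [CommRing Z] [IsDomain Z] [IsPrincipalIdealRing Z]
    [CommRing E] [Nontrivial E] [Algebra Z E] (pb : PowerBasis Z E) [Ring R] [Algebra Z R]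
    [Module.Finite Z R] (ι : E →ₐ[Z] R) (hι : Function.Injective ι)
    (hsat : ∀ (z : Z) (x : R), z ≠ 0 → z • x ∈ Set.range ι → x ∈ Set.range ι)
    (J : Ideal E) (e : E) (he : ι e ∈ AddSubgroup.closure {y | ∃ w : R, ∃ j ∈ J, y = w * ι j}) :
    e ∈ J := by
  obtain ⟨l, hl0, hl⟩ := exists_perfect_functional pb
  let N : Submodule Z R := LinearMap.range ι.toLinearMap
  have htf : Module.IsTorsionFree Z (R ⧸ N) := by
    rw [Module.isTorsionFree_iff_smul_eq_zero]
    intro z x hx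
    by_cases hz : z = 0
    · exact Or.inl hz
    · right
      obtain ⟨x, rfl⟩ := Submodule.Quotient.mk_surjective _ x
      rw [← Submodule.Quotient.mk_smul, Submodule.Quotient.mk_eq_zero] at hx
      rw [Submodule.Quotient.mk_eq_zero]
      exact hsat z x hz hx
  have : Module.Free Z (R ⧸ N) := Module.free_of_finite_type_torsion_free'
  obtain ⟨s, hs⟩ := Module.projective_lifting_property N.mkQ LinearMap.id N.mkQ_surjective
  have hsx : ∀ x, x - s (N.mkQ x) ∈ N := by
    intro x
    rw [← Submodule.Quotient.mk_eq_zero, Submodule.Quotient.mk_sub, sub_eq_zero]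
    exact (LinearMap.congr_fun hs (N.mkQ x)).symm
  let eN : E ≃ₗ[Z] N := LinearEquiv.ofInjective ι.toLinearMap hι
  let p : R →ₗ[Z] E := eN.symm.toLinearMap ∘ₗ
    LinearMap.codRestrict N (LinearMap.id - s ∘ₗ N.mkQ) hsx
  have hp : ∀ e, p (ι e) = e := by
    intro e
    have h0 : N.mkQ (ι e) = 0 := by
      rw [Submodule.mkQ_apply, Submodule.Quotient.mk_eq_zero]; exact ⟨e, rfl⟩
    apply eN.injective
    apply Subtype.ext
    simp only [p, LinearMap.comp_apply, LinearEquiv.coe_coe, LinearEquiv.apply_symm_apply,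
      LinearMap.codRestrict_apply, LinearMap.sub_apply, h0, map_zero, sub_zero]
    rfl
  have hex : ∀ w : R, ∃ b, ∀ e, l (p (w * ι e)) = l (b * e) := fun w =>
    hl (l ∘ₗ p ∘ₗ LinearMap.mulLeft Z w ∘ₗ ι.toLinearMap)
  choose ρ hρ using hex
  have huniq : ∀ a b : E, (∀ e, l (a * e) = l (b * e)) → a = b := fun a b h =>
    sub_eq_zero.mp (hl0 _ fun e => by rw [sub_mul, map_sub, h, sub_self])
  have hρι : ∀ e, ρ (ι e) = e := fun e => huniq _ _ fun e' => by
    rw [← hρ, ← map_mul, hp]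
  have hρadd : ∀ a b, ρ (a + b) = ρ a + ρ b := fun a b => huniq _ _ fun e' => by
    rw [← hρ, add_mul, map_add, map_add, hρ, hρ, add_mul, map_add]
  have hρmul : ∀ w e, ρ (w * ι e) = ρ w * e := fun w e => huniq _ _ fun e' => by
    rw [← hρ, mul_assoc, ← map_mul, hρ, mul_assoc]
  let ρ' : R →+ E := AddMonoidHom.mk' ρ hρadd
  have hle : AddSubgroup.closure {y | ∃ w : R, ∃ j ∈ J, y = w * ι j} ≤
      J.toAddSubgroup.comap ρ' := by
    rw [AddSubgroup.closure_le]
    rintro _ ⟨w, j, hj, rfl⟩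
    change ρ (w * ι j) ∈ J
    rw [hρmul]
    exact J.mul_mem_left _ hj
  have : ρ (ι e) ∈ J := hle he
  rwa [hρι] at this

/-- Artin's independence argument. -/
theorem eq_zero_of_forall_sum_eq_zero {Z E R : Type*} [CommRing Z] [IsDomain Z] [CommRing E]
    [Algebra Z E] [Ring R] [IsDomain R] [Algebra Z R] [Algebra.IsAlgebraic Z R]
    [Module.IsTorsionFree Z R] (ι : E →ₐ[Z] R)
    (hcent : ∀ x : R, (∀ e, x * ι e = ι e * x) → x ∈ Set.range ι)
    {J : Type*} [Fintype J] (x : J → R)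
    (hx : ∀ b : J → E, ∑ j, ι (b j) * x j = 0 → b = 0)
    (c : J → R) (hc : ∀ e, ∑ j, c j * (ι e * x j) = 0) : c = 0 := by
  classical
  induction hN : (Finset.univ.filter fun j => c j ≠ 0).card using Nat.strong_induction_on
    generalizing c with
  | _ N ih =>
  by_contra hne
  obtain ⟨j₀, hj₀⟩ := Function.ne_iff.mp hne
  obtain ⟨t, -, z, hz, hst⟩ := (Algebra.IsAlgebraic.isAlgebraic (R := Z) (c j₀)).exists_nonzero_eq_adjoin_mul
    (mem_nonZeroDivisors_of_ne_zero hj₀)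
  have hts : t * c j₀ = algebraMap Z R z := by
    apply mul_left_cancel₀ hj₀
    rw [← mul_assoc, hst, Algebra.commutes]
  have ht : t ≠ 0 := by
    rintro rfl
    rw [zero_mul, eq_comm, Algebra.algebraMap_eq_smul_one] at hts
    exact (smul_eq_zero.mp hts).elim hz one_ne_zero
  have hcomm : ∀ d : E, (fun j => t * c j * ι d - ι d * (t * c j)) = 0 := by
    intro d
    refine ih _ ?_ _ ?_ rfl
    · rw [← hN]
      apply Finset.card_lt_card
      refine (Finset.ssubset_iff_of_subset ?_).2 ⟨j₀, by simpa using hj₀, ?_⟩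
      · intro j
        simp only [Finset.mem_filter, Finset.mem_univ, true_and]
        contrapose!
        intro h
        simp [h]
      · simp [hts, Algebra.commutes]
    · intro e
      have h1 := congrArg (t * ·) (hc (d * e))
      have h2 := congrArg (ι d * t * ·) (hc e)
      simp only [mul_zero, Finset.mul_sum] at h1 h2
      calc _ = ∑ j, (t * (c j * (ι (d * e) * x j)) - ι d * t * (c j * (ι e * x j))) := by
            refine Finset.sum_congr rfl fun j _ => ?_
            rw [map_mul]; noncomm_ring
        _ = 0 := by rw [Finset.sum_sub_distrib, h1, h2, sub_zero]
  have hmem : ∀ j, ∃ b, ι b = t * c j := fun j => hcent _ fun d => by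
    exact sub_eq_zero.mp (congrFun (hcomm d) j)
  choose b hb using hmem
  have hb0 : b = 0 := by
    apply hx
    have h1 := congrArg (t * ·) (hc 1)
    simp only [mul_zero, Finset.mul_sum] at h1
    rw [← h1]
    refine Finset.sum_congr rfl fun j _ => ?_
    rw [hb, map_one, one_mul, mul_assoc]
  have := hb j₀
  rw [hb0, Pi.zero_apply, map_zero, eq_comm, mul_eq_zero] at this
  exact this.elim ht hj₀

/-- A commutative subring `E` of a noncommutative domain `R` that is its own centralizer has rank
at least the square root of the rank of `R`. -/
theorem finrank_le_sq {Z E R : Type*} [CommRing Z] [IsDomain Z] [IsPrincipalIdealRing Z]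
    [CommRing E] [Algebra Z E] [Module.Finite Z E] [Module.Free Z E]
    [Ring R] [IsDomain R] [Algebra Z R] [Module.Finite Z R] [Module.IsTorsionFree Z R]
    (ι : E →ₐ[Z] R) (hι : Function.Injective ι)
    (hcent : ∀ x : R, (∀ e, x * ι e = ι e * x) → x ∈ Set.range ι) :
    Module.finrank Z R ≤ Module.finrank Z E ^ 2 := by
  have : Nontrivial E := ⟨0, 1, fun h => zero_ne_one (by rw [← map_zero ι, h, map_one])⟩
  have : NoZeroDivisors E := hι.noZeroDivisors ι (map_zero ι) (map_mul ι)
  have : IsDomain E := NoZeroDivisors.to_isDomain E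
  let _ : Module E R := Module.compHom R ι.toRingHom
  have hsm : ∀ (e : E) (x : R), e • x = ι e * x := fun e x => rfl
  have : IsScalarTower Z E R := ⟨fun z e x => by
    rw [hsm, hsm, map_smul, smul_mul_assoc]⟩
  have : Module.Finite E R := Module.Finite.of_restrictScalars_finite Z E R
  have : IsNoetherianRing R := IsNoetherianRing.of_finite Z R
  obtain ⟨s, hs, hli⟩ := exists_finset_linearIndependent_of_le_finrank
    (le_refl (Module.finrank E R))
  let x : s → R := Subtype.val
  let N : Submodule E R := Submodule.span E (Set.range x)
  have bN : Module.Basis s E N := Module.Basis.span hli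
  have : Module.Free E N := Module.Free.of_basis bN
  have hN : Module.finrank E N = s.card := by
    rw [Module.finrank_eq_card_basis bN, Fintype.card_coe]
  have hq : Module.finrank E (R ⧸ N) = 0 := by
    have := N.finrank_quotient_add_finrank
    omega
  have hqZ : Module.finrank Z (R ⧸ N) = 0 := by
    rw [Module.finrank_eq_zero_iff_isTorsion] at hq ⊢
    intro y
    obtain ⟨⟨e, he⟩, hey⟩ := @hq y
    obtain ⟨z, hz, e', he'⟩ := (Algebra.IsAlgebraic.isAlgebraic (R := Z) e).exists_nonzero_dvd he
    refine ⟨⟨z, mem_nonZeroDivisors_of_ne_zero hz⟩, ?_⟩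
    change z • y = 0
    rw [← algebraMap_smul E z y, he', mul_comm, mul_smul]
    change e' • e • y = 0
    rw [show e • y = 0 from hey, smul_zero]
  have hZR : Module.finrank Z R = Module.finrank Z E * s.card := by
    have h1 := (N.restrictScalars Z).finrank_quotient_add_finrank
    have h2 := Module.finrank_mul_finrank Z E N
    rw [← h1, ← hN, h2]
    have h3 : Module.finrank Z (R ⧸ N.restrictScalars Z) = 0 := hqZ
    rw [h3, zero_add]
    rfl
  have hcard : s.card ≤ Module.finrank Z E := by
    let b := Module.finBasis Z E
    let y : Fin s.card → R := x ∘ s.equivFin.symm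
    let f : (Fin s.card → R) →ₗ[R] (Fin (Module.finrank Z E) → R) :=
      { toFun := fun c i => ∑ j, c j * (ι (b i) * y j)
        map_add' := fun c c' => by
          ext i; simp [add_mul, Finset.sum_add_distrib]
        map_smul' := fun r c => by
          ext i; simp [mul_assoc, Finset.mul_sum] }
    refine le_of_fin_injective R f ((injective_iff_map_eq_zero f).2 fun c hc => ?_)
    refine eq_zero_of_forall_sum_eq_zero ι hcent y ?_ c ?_
    · intro a ha
      have h1 : LinearIndependent E y := hli.comp _ s.equivFin.symm.injective
      rw [Fintype.linearIndependent_iff] at h1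
      exact funext (h1 a ha)
    · intro e
      rw [← b.sum_repr e]
      simp only [map_sum, map_smul, Finset.sum_mul, Finset.mul_sum]
      rw [Finset.sum_comm]
      refine Finset.sum_eq_zero fun i _ => ?_
      have h1 := congrArg (b.repr e i • ·) (congrFun hc i)
      simp only [f, LinearMap.coe_mk, AddHom.coe_mk, Pi.zero_apply, smul_zero,
        Finset.smul_sum] at h1
      rw [← h1]
      refine Finset.sum_congr rfl fun j _ => ?_
      rw [smul_mul_assoc, mul_smul_comm]
  rw [hZR, sq]
  exact Nat.mul_le_mul_left _ hcard

end PowerBases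

section Skew

set_option linter.unusedSectionVars false

variable {p m : ℕ} [Fact p.Prime]
variable {Fq k : Type} [Field Fq] [Fintype Fq] [Field k] [Fintype k] [CharP k p]
variable {hFq : Fintype.card Fq = p ^ m}

local notation "𝔮" => Fintype.card Fq
local notation "𝓔" => AddMonoid.End (Kb k)
local notation "τ" => tau p m Fq k hFq
local notation "𝓡" => skewPoly p m Fq k hFq
local notation "ofC" => ofCoeffs p m Fq k hFq

theorem end_mul_apply (u v : 𝓔) (x : Kb k) : (u * v) x = u (v x) := rfl

theorem end_add_apply (u v : 𝓔) (x : Kb k) : (u + v) x = u x + v x := rfl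

theorem tau_apply (x : Kb k) : τ x = x ^ 𝔮 := rfl

theorem ml_apply (c : k) (x : Kb k) : ml k c x = algebraMap k (Kb k) c * x := rfl

theorem tau_pow_apply (i : ℕ) (x : Kb k) : (τ ^ i) x = x ^ 𝔮 ^ i := by
  induction i generalizing x with
  | zero => simp
  | succ i ih =>
    rw [pow_succ, end_mul_apply, ih, tau_apply, ← pow_mul, ← pow_succ']

/-- Multiplication by scalars of `k`, as a ring homomorphism. -/
def mlHom (k : Type) [Field k] : k →+* AddMonoid.End (Kb k) where
  toFun := ml k
  map_one' := by ext x; simp [ml_apply]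
  map_mul' a b := by ext x; simp [ml_apply, mul_assoc]
  map_zero' := by ext x; simp [ml_apply]
  map_add' a b := by ext x; simp [ml_apply, end_add_apply, add_mul]

theorem ml_mul (a b : k) : ml k (a * b) = ml k a * ml k b := map_mul (mlHom k) a b
theorem ml_one : ml k 1 = 1 := map_one (mlHom k)
theorem ml_zero : ml k 0 = 0 := map_zero (mlHom k)

theorem ml_inv_mul_ml {c : k} (hc : c ≠ 0) : ml k c⁻¹ * ml k c = 1 := by
  rw [← ml_mul, inv_mul_cancel₀ hc, ml_one]

theorem tau_pow_mul_ml (i : ℕ) (a : k) : τ ^ i * ml k a = ml k (a ^ 𝔮 ^ i) * τ ^ i := by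
  ext x
  simp only [end_mul_apply, tau_pow_apply, ml_apply, mul_pow, map_pow]

theorem tau_mem : τ ∈ 𝓡 := Subring.subset_closure (Set.mem_insert _ _)

theorem ml_mem (a : k) : ml k a ∈ 𝓡 :=
  Subring.subset_closure (Set.mem_insert_of_mem _ ⟨a, rfl⟩)

theorem ofCoeffs_mem (c : ℕ →₀ k) : ofC c ∈ 𝓡 :=
  Subring.sum_mem _ fun i _ => mul_mem (ml_mem _) (pow_mem tau_mem i)

variable (p m Fq k hFq) in
/-- `ofCoeffs` as an additive homomorphism. -/
def ofCoeffsHom : (ℕ →₀ k) →+ AddMonoid.End (Kb k) :=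
  Finsupp.liftAddHom fun i => (AddMonoidHom.mulRight (tau p m Fq k hFq ^ i)).comp
    (mlHom k : k →+ AddMonoid.End (Kb k))

theorem ofCoeffsHom_apply (c : ℕ →₀ k) : ofCoeffsHom p m Fq k hFq c = ofC c := rfl

theorem ofCoeffs_single (i : ℕ) (a : k) : ofC (Finsupp.single i a) = ml k a * τ ^ i := by
  simp [ofCoeffs, ml_zero]

variable (Fq) in
/-- The twisted product of coefficient families. -/
def skewMul (c d : ℕ →₀ k) : ℕ →₀ k :=
  c.sum fun i a => d.sum fun j b => Finsupp.single (i + j) (a * b ^ Fintype.card Fq ^ i)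

theorem ofCoeffs_skewMul (c d : ℕ →₀ k) : ofC (skewMul Fq c d) = ofC c * ofC d := by
  rw [← ofCoeffsHom_apply, skewMul, Finsupp.sum, map_sum, ofCoeffs, Finsupp.sum, Finset.sum_mul]
  refine Finset.sum_congr rfl fun i _ => ?_
  rw [Finsupp.sum, map_sum, ofCoeffs, Finsupp.sum, Finset.mul_sum]
  refine Finset.sum_congr rfl fun j _ => ?_
  rw [ofCoeffsHom_apply, ofCoeffs_single, ml_mul, pow_add]
  simp only [mul_assoc]
  rw [← mul_assoc (τ ^ i), tau_pow_mul_ml, mul_assoc]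

theorem mem_skewPoly_iff (w : 𝓔) : w ∈ 𝓡 ↔ ∃ c, ofC c = w := by
  constructor
  · let S : Subring 𝓔 :=
      { carrier := {w | ∃ c, ofC c = w}
        mul_mem' := by
          rintro _ _ ⟨c, rfl⟩ ⟨d, rfl⟩
          exact ⟨_, ofCoeffs_skewMul c d⟩
        one_mem' := ⟨Finsupp.single 0 1, by rw [ofCoeffs_single, ml_one]; simp⟩
        add_mem' := by
          rintro _ _ ⟨c, rfl⟩ ⟨d, rfl⟩
          exact ⟨c + d, map_add (ofCoeffsHom p m Fq k hFq) c d⟩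
        zero_mem' := ⟨0, map_zero (ofCoeffsHom p m Fq k hFq)⟩
        neg_mem' := by
          rintro _ ⟨c, rfl⟩
          exact ⟨-c, map_neg (ofCoeffsHom p m Fq k hFq) c⟩ }
    have : 𝓡 ≤ S := by
      refine Subring.closure_le.2 (Set.insert_subset ?_ ?_)
      · exact ⟨Finsupp.single 1 1, by rw [ofCoeffs_single, ml_one]; simp⟩
      · rintro _ ⟨a, rfl⟩
        exact ⟨Finsupp.single 0 a, by rw [ofCoeffs_single]; simp⟩
    exact fun h => this h
  · rintro ⟨c, rfl⟩
    exact ofCoeffs_mem c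

theorem ofCoeffs_apply (c : ℕ →₀ k) (x : Kb k) :
    ofC c x = ∑ i ∈ c.support, algebraMap k (Kb k) (c i) * x ^ 𝔮 ^ i := by
  have : ∀ s : Finset ℕ, (∑ i ∈ s, ml k (c i) * τ ^ i) x =
      ∑ i ∈ s, algebraMap k (Kb k) (c i) * x ^ 𝔮 ^ i := by
    intro s
    induction s using Finset.cons_induction with
    | empty => rfl
    | cons a s ha ih =>
      rw [Finset.sum_cons, Finset.sum_cons, end_add_apply, ih,
        end_mul_apply, tau_pow_apply, ml_apply]
  exact this _

theorem card_le_of_ofCoeffs_eq_zero {c : ℕ →₀ k} (hc : c ≠ 0) {D : ℕ} (hD : ∀ i, D < i → c i = 0)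
    (s : Finset (Kb k)) (hs : ∀ x ∈ s, ofC c x = 0) : s.card ≤ 𝔮 ^ D := by
  have hq : 1 < 𝔮 := Fintype.one_lt_card
  let f : (Kb k)[X] := ∑ i ∈ c.support, C (algebraMap k (Kb k) (c i)) * X ^ 𝔮 ^ i
  have hf : f ≠ 0 := by
    obtain ⟨j, hj⟩ := Finsupp.ne_iff.mp hc
    intro h0
    have := congrArg (coeff · (𝔮 ^ j)) h0
    simp only [f, finsetSum_coeff, coeff_C_mul, coeff_X_pow, coeff_zero,
      Nat.pow_right_inj hq] at this
    simp at this
    exact hj (by simpa using this)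
  have hdeg : f.natDegree ≤ 𝔮 ^ D := by
    refine natDegree_sum_le_of_forall_le _ _ fun i hi => ?_
    refine (natDegree_C_mul_X_pow_le _ _).trans (Nat.pow_le_pow_right hq.le ?_)
    by_contra h
    exact Finsupp.mem_support_iff.1 hi (hD i (by omega))
  refine le_trans ?_ hdeg
  refine card_le_degree_of_subset_roots fun x hx => ?_
  rw [mem_roots hf, IsRoot.def, eval_finsetSum]
  simpa [ofCoeffs_apply] using hs x hx

theorem ofCoeffs_injective : Function.Injective (ofCoeffs p m Fq k hFq) := by
  refine (injective_iff_map_eq_zero (ofCoeffsHom p m Fq k hFq)).2 fun c hc => ?_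
  by_contra hne
  have hD : ∀ i, c.support.sup id < i → c i = 0 := fun i hi => by
    by_contra h
    exact absurd (Finset.le_sup (f := id) (Finsupp.mem_support_iff.2 h)) (not_le.2 hi)
  have hinf : Infinite (Kb k) := IsAlgClosed.instInfinite
  obtain ⟨s, hs⟩ := Infinite.exists_subset_card_eq (Kb k) (𝔮 ^ (c.support.sup id) + 1)
  have := card_le_of_ofCoeffs_eq_zero hne hD s fun x _ => by
    rw [← ofCoeffsHom_apply (hFq := hFq), hc]; rfl
  omega

variable (p m Fq k hFq) in
/-- The coefficients of an element of `k{τ}`. -/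
def skewCoeff (w : AddMonoid.End (Kb k)) : ℕ →₀ k :=
  Function.invFun (ofCoeffs p m Fq k hFq) w

local notation "cf" => skewCoeff p m Fq k hFq

theorem skewCoeff_ofCoeffs (c : ℕ →₀ k) : cf (ofC c) = c :=
  Function.leftInverse_invFun ofCoeffs_injective c

theorem ofCoeffs_skewCoeff {w : 𝓔} (hw : w ∈ 𝓡) : ofC (cf w) = w := by
  obtain ⟨c, rfl⟩ := (mem_skewPoly_iff w).1 hw
  rw [skewCoeff_ofCoeffs]

theorem skewCoeff_zero : cf 0 = 0 := skewCoeff_ofCoeffs 0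

theorem skewCoeff_eq_zero_iff {w : 𝓔} (hw : w ∈ 𝓡) : cf w = 0 ↔ w = 0 := by
  constructor
  · intro h
    rw [← ofCoeffs_skewCoeff hw, h]; rfl
  · rintro rfl
    exact skewCoeff_zero

theorem skewCoeff_add {w v : 𝓔} (hw : w ∈ 𝓡) (hv : v ∈ 𝓡) : cf (w + v) = cf w + cf v := by
  obtain ⟨c, rfl⟩ := (mem_skewPoly_iff w).1 hw
  obtain ⟨d, rfl⟩ := (mem_skewPoly_iff v).1 hv
  rw [skewCoeff_ofCoeffs, skewCoeff_ofCoeffs]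
  exact (congrArg cf (map_add (ofCoeffsHom p m Fq k hFq) c d).symm).trans (skewCoeff_ofCoeffs _)

theorem skewCoeff_neg {w : 𝓔} (hw : w ∈ 𝓡) : cf (-w) = -cf w := by
  obtain ⟨c, rfl⟩ := (mem_skewPoly_iff w).1 hw
  rw [skewCoeff_ofCoeffs]
  exact (congrArg cf (map_neg (ofCoeffsHom p m Fq k hFq) c).symm).trans (skewCoeff_ofCoeffs _)

theorem skewCoeff_sub {w v : 𝓔} (hw : w ∈ 𝓡) (hv : v ∈ 𝓡) : cf (w - v) = cf w - cf v := by
  rw [sub_eq_add_neg, skewCoeff_add hw (neg_mem hv), skewCoeff_neg hv, sub_eq_add_neg]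

theorem skewCoeff_mul {w v : 𝓔} (hw : w ∈ 𝓡) (hv : v ∈ 𝓡) :
    cf (w * v) = skewMul Fq (cf w) (cf v) := by
  rw [← skewCoeff_ofCoeffs (hFq := hFq) (skewMul Fq _ _), ofCoeffs_skewMul,
    ofCoeffs_skewCoeff hw, ofCoeffs_skewCoeff hv]

theorem skewCoeff_ml_mul_tau_pow (a : k) (i : ℕ) :
    cf (ml k a * τ ^ i) = Finsupp.single i a := by
  rw [← ofCoeffs_single, skewCoeff_ofCoeffs]

theorem skewCoeff_ml (a : k) : cf (ml k a) = Finsupp.single 0 a := by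
  simpa using skewCoeff_ml_mul_tau_pow (hFq := hFq) a 0

theorem skewMul_apply (c d : ℕ →₀ k) (N : ℕ) : skewMul Fq c d N =
    ∑ i ∈ c.support, ∑ j ∈ d.support, if i + j = N then c i * d j ^ 𝔮 ^ i else 0 := by
  simp only [skewMul, Finsupp.sum, Finsupp.finsetSum_apply, Finsupp.single_apply]

theorem skewCoeff_mul_eq_zero {w v : 𝓔} (hw : w ∈ 𝓡) (hv : v ∈ 𝓡) {N : ℕ}
    (h : ∀ i j, cf w i ≠ 0 → cf v j ≠ 0 → i + j ≠ N) : cf (w * v) N = 0 := by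
  rw [skewCoeff_mul hw hv, skewMul_apply]
  refine Finset.sum_eq_zero fun i hi => Finset.sum_eq_zero fun j hj => if_neg ?_
  exact h i j (Finsupp.mem_support_iff.1 hi) (Finsupp.mem_support_iff.1 hj)

theorem skewCoeff_mul_eq {w v : 𝓔} (hw : w ∈ 𝓡) (hv : v ∈ 𝓡) {a b : ℕ}
    (h : ∀ i j, cf w i ≠ 0 → cf v j ≠ 0 → i + j = a + b → i = a) :
    cf (w * v) (a + b) = cf w a * cf v b ^ 𝔮 ^ a := by
  have hq : 𝔮 ≠ 0 := Fintype.card_ne_zero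
  rw [skewCoeff_mul hw hv, skewMul_apply, Finset.sum_eq_single a, Finset.sum_eq_single b]
  · simp
  · intro j _ hj
    exact if_neg (by omega)
  · intro hb
    rw [Finsupp.notMem_support_iff.1 hb]
    simp [hq]
  · intro i hi hia
    refine Finset.sum_eq_zero fun j hj => if_neg fun hij => hia ?_
    exact h i j (Finsupp.mem_support_iff.1 hi) (Finsupp.mem_support_iff.1 hj) hij
  · intro ha
    rw [Finsupp.notMem_support_iff.1 ha]
    simp

theorem one_lt_card_base : 1 < 𝔮 := Fintype.one_lt_card

variable (p m Fq k hFq) in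
/-- The `τ`-degree. -/
def skewDeg (w : AddMonoid.End (Kb k)) : ℕ := (skewCoeff p m Fq k hFq w).support.sup id

variable (p m Fq k hFq) in
/-- The `τ`-degree of the lowest nonzero term. -/
def skewOrd (w : AddMonoid.End (Kb k)) : ℕ := sInf {i | skewCoeff p m Fq k hFq w i ≠ 0}

local notation "deg" => skewDeg p m Fq k hFq
local notation "ord" => skewOrd p m Fq k hFq

theorem le_skewDeg {w : 𝓔} {i : ℕ} (h : cf w i ≠ 0) : i ≤ deg w :=
  Finset.le_sup (f := id) (Finsupp.mem_support_iff.2 h)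

theorem skewCoeff_eq_zero_of_skewDeg_lt {w : 𝓔} {i : ℕ} (h : deg w < i) : cf w i = 0 := by
  by_contra h'
  exact absurd (le_skewDeg h') (not_le.2 h)

theorem skewOrd_le {w : 𝓔} {i : ℕ} (h : cf w i ≠ 0) : ord w ≤ i := Nat.sInf_le h

theorem exists_skewCoeff_ne_zero {w : 𝓔} (hw : w ∈ 𝓡) (h : w ≠ 0) : ∃ i, cf w i ≠ 0 :=
  Finsupp.ne_iff.1 (mt (skewCoeff_eq_zero_iff hw).1 h)

theorem skewCoeff_skewOrd_ne_zero {w : 𝓔} (hw : w ∈ 𝓡) (h : w ≠ 0) : cf w (ord w) ≠ 0 :=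
  Nat.sInf_mem (exists_skewCoeff_ne_zero hw h)

theorem skewCoeff_skewDeg_ne_zero {w : 𝓔} (hw : w ∈ 𝓡) (h : w ≠ 0) : cf w (deg w) ≠ 0 := by
  obtain ⟨i, hi⟩ := exists_skewCoeff_ne_zero hw h
  obtain ⟨j, hj, hj'⟩ := Finset.exists_mem_eq_sup (cf w).support
    ⟨i, Finsupp.mem_support_iff.2 hi⟩ id
  rw [skewDeg, hj']
  exact Finsupp.mem_support_iff.1 hj

theorem skewDeg_eq {w : 𝓔} {i : ℕ} (h : cf w i ≠ 0) (h' : ∀ j, i < j → cf w j = 0) :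
    deg w = i := by
  refine le_antisymm (Finset.sup_le fun j hj => ?_) (le_skewDeg h)
  by_contra hlt
  exact Finsupp.mem_support_iff.1 hj (h' j (not_le.1 hlt))

theorem skewOrd_eq {w : 𝓔} {i : ℕ} (h : cf w i ≠ 0) (h' : ∀ j, j < i → cf w j = 0) :
    ord w = i := by
  refine le_antisymm (skewOrd_le h) (le_csInf ⟨i, h⟩ fun j hj => ?_)
  by_contra hlt
  exact hj (h' j (not_le.1 hlt))

theorem skewCoeff_mul_deg {w v : 𝓔} (hw : w ∈ 𝓡) (hv : v ∈ 𝓡) :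
    cf (w * v) (deg w + deg v) = cf w (deg w) * cf v (deg v) ^ 𝔮 ^ deg w :=
  skewCoeff_mul_eq hw hv fun i j hi hj _ => by
    have := le_skewDeg hi
    have := le_skewDeg hj
    omega

theorem skewCoeff_mul_ord {w v : 𝓔} (hw : w ∈ 𝓡) (hv : v ∈ 𝓡) :
    cf (w * v) (ord w + ord v) = cf w (ord w) * cf v (ord v) ^ 𝔮 ^ ord w :=
  skewCoeff_mul_eq hw hv fun i j hi hj _ => by
    have := skewOrd_le hi
    have := skewOrd_le hj
    omega

theorem skewCoeff_mul_deg_ne_zero {w v : 𝓔} (hw : w ∈ 𝓡) (hv : v ∈ 𝓡) (hw0 : w ≠ 0)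
    (hv0 : v ≠ 0) : cf (w * v) (deg w + deg v) ≠ 0 := by
  rw [skewCoeff_mul_deg hw hv]
  exact mul_ne_zero (skewCoeff_skewDeg_ne_zero hw hw0)
    (pow_ne_zero _ (skewCoeff_skewDeg_ne_zero hv hv0))

theorem skew_mul_ne_zero {w v : 𝓔} (hw : w ∈ 𝓡) (hv : v ∈ 𝓡) (hw0 : w ≠ 0)
    (hv0 : v ≠ 0) : w * v ≠ 0 := fun h =>
  skewCoeff_mul_deg_ne_zero hw hv hw0 hv0 (by rw [h, skewCoeff_zero]; rfl)

instance : IsDomain 𝓡 := by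
  have : NoZeroDivisors 𝓡 := ⟨fun {a b} h => by
    by_contra! hab
    exact skew_mul_ne_zero a.2 b.2 (fun h => hab.1 (Subtype.ext h))
      (fun h => hab.2 (Subtype.ext h)) (congrArg Subtype.val h)⟩
  have : Nontrivial 𝓡 := ⟨0, 1, fun h => by
    have h1 := congrArg Subtype.val h
    have h2 := DFunLike.congr_fun h1 1
    exact zero_ne_one h2⟩
  exact NoZeroDivisors.to_isDomain _

theorem skew_mul_right_cancel {w v v' : 𝓔} (hw : w ∈ 𝓡) (hv : v ∈ 𝓡) (hv' : v' ∈ 𝓡)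
    (hw0 : w ≠ 0) (h : v * w = v' * w) : v = v' := by
  by_contra hne
  refine skew_mul_ne_zero (sub_mem hv hv') hw (sub_ne_zero.2 hne) hw0 ?_
  rw [sub_mul, h, sub_self]

theorem skewDeg_mul {w v : 𝓔} (hw : w ∈ 𝓡) (hv : v ∈ 𝓡) (hw0 : w ≠ 0) (hv0 : v ≠ 0) :
    deg (w * v) = deg w + deg v := by
  refine skewDeg_eq (skewCoeff_mul_deg_ne_zero hw hv hw0 hv0) fun N hN => ?_
  refine skewCoeff_mul_eq_zero hw hv fun i j hi hj => ?_
  have := le_skewDeg hi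
  have := le_skewDeg hj
  omega

theorem skewOrd_mul {w v : 𝓔} (hw : w ∈ 𝓡) (hv : v ∈ 𝓡) (hw0 : w ≠ 0) (hv0 : v ≠ 0) :
    ord (w * v) = ord w + ord v := by
  refine skewOrd_eq ?_ fun N hN => ?_
  · rw [skewCoeff_mul_ord hw hv]
    exact mul_ne_zero (skewCoeff_skewOrd_ne_zero hw hw0)
      (pow_ne_zero _ (skewCoeff_skewOrd_ne_zero hv hv0))
  · refine skewCoeff_mul_eq_zero hw hv fun i j hi hj => ?_
    have := skewOrd_le hi
    have := skewOrd_le hj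
    omega

theorem skewDeg_ml (c : k) : deg (ml k c) = 0 := by
  by_cases hc : c = 0
  · rw [hc, ml_zero, skewDeg, skewCoeff_zero]; simp
  · refine skewDeg_eq ?_ fun j hj => ?_
    · rw [skewCoeff_ml]; simpa
    · rw [skewCoeff_ml, Finsupp.single_eq_of_ne (by omega)]

theorem tau_pow_ne_zero (i : ℕ) : τ ^ i ≠ 0 := by
  intro h
  have := skewCoeff_ml_mul_tau_pow (hFq := hFq) (1 : k) i
  rw [h, mul_zero, skewCoeff_zero] at this
  simpa using DFunLike.congr_fun this i

theorem skewCoeff_tau_pow (i : ℕ) : cf (τ ^ i) = Finsupp.single i 1 := by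
  rw [← skewCoeff_ml_mul_tau_pow (hFq := hFq), ml_one, one_mul]

theorem skewOrd_tau_pow (i : ℕ) : ord (τ ^ i) = i := by
  refine skewOrd_eq ?_ fun j hj => ?_
  · rw [skewCoeff_tau_pow]; simp
  · rw [skewCoeff_tau_pow, Finsupp.single_eq_of_ne (by omega)]

theorem eq_ml_of_skewDeg_eq_zero {w : 𝓔} (hw : w ∈ 𝓡) (h : deg w = 0) : w = ml k (cf w 0) := by
  have : cf w = Finsupp.single 0 (cf w 0) := by
    ext i
    by_cases hi : i = 0
    · rw [hi, Finsupp.single_eq_same]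
    · rw [Finsupp.single_eq_of_ne hi]
      exact skewCoeff_eq_zero_of_skewDeg_lt (by omega)
  conv_lhs => rw [← ofCoeffs_skewCoeff hw, this, ofCoeffs_single]
  simp

/-- Right division by `τ ^ h`. -/
theorem exists_eq_mul_tau_pow {w : 𝓔} (hw : w ∈ 𝓡) (h : ℕ) (hh : ∀ i < h, cf w i = 0) :
    ∃ v ∈ 𝓡, w = v * τ ^ h := by
  refine ⟨ofC ((cf w).comapDomain (· + h) (add_left_injective h).injOn), ofCoeffs_mem _, ?_⟩
  have hs : ofC (Finsupp.single h 1) = τ ^ h := by rw [ofCoeffs_single, ml_one, one_mul]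
  rw [← hs, ← ofCoeffs_skewMul]
  conv_lhs => rw [← ofCoeffs_skewCoeff hw]
  congr 1
  ext N
  by_cases hN : N < h
  · rw [hh N hN, skewMul_apply]
    refine (Finset.sum_eq_zero fun i _ => Finset.sum_eq_zero fun j hj => if_neg ?_).symm
    rw [Finsupp.mem_support_iff, Finsupp.single_apply_ne_zero] at hj
    omega
  · obtain ⟨i, rfl⟩ := Nat.exists_eq_add_of_le' (not_lt.1 hN)
    rw [← skewCoeff_ofCoeffs (hFq := hFq) (skewMul Fq _ _), ofCoeffs_skewMul,
      skewCoeff_mul_eq (ofCoeffs_mem _) (ofCoeffs_mem _), skewCoeff_ofCoeffs, skewCoeff_ofCoeffs]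
    · simp
    · intro i' j _ hj hij
      rw [skewCoeff_ofCoeffs, Finsupp.single_apply_ne_zero] at hj
      omega

/-- Right division with remainder. -/
theorem exists_eq_mul_add {u : 𝓔} (hu : u ∈ 𝓡) (hu0 : u ≠ 0) {w : 𝓔} (hw : w ∈ 𝓡) :
    ∃ a ∈ 𝓡, ∃ b ∈ 𝓡, w = a * u + b ∧ ∀ i, deg u ≤ i → cf b i = 0 := by
  suffices H : ∀ N, ∀ w ∈ 𝓡, (∀ i, N ≤ i → cf w i = 0) →
      ∃ a ∈ 𝓡, ∃ b ∈ 𝓡, w = a * u + b ∧ ∀ i, deg u ≤ i → cf b i = 0 from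
    H (deg w + 1) w hw fun i hi => skewCoeff_eq_zero_of_skewDeg_lt (by omega)
  intro N
  induction N with
  | zero => exact fun w hw h => ⟨0, zero_mem _, w, hw, by simp, fun i _ => h i (Nat.zero_le i)⟩
  | succ M ih =>
    intro w hw h
    by_cases hM : M < deg u
    · exact ⟨0, zero_mem _, w, hw, by simp, fun i hi => h i (by omega)⟩
    · obtain ⟨j, rfl⟩ := Nat.exists_eq_add_of_le' (not_lt.1 hM)
      let c := cf w (j + deg u) / cf u (deg u) ^ 𝔮 ^ j
      have hmem : ml k c * τ ^ j ∈ 𝓡 := mul_mem (ml_mem _) (pow_mem tau_mem _)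
      have hcf : ∀ i, cf (ml k c * τ ^ j) i ≠ 0 → i = j := fun i hi => by
        rw [skewCoeff_ml_mul_tau_pow, Finsupp.single_apply_ne_zero] at hi
        exact hi.1
      obtain ⟨a, ha, b, hb, hab, hb'⟩ := ih (w - ml k c * τ ^ j * u)
        (sub_mem hw (mul_mem hmem hu)) fun i hi => by
          rw [skewCoeff_sub hw (mul_mem hmem hu), Finsupp.sub_apply]
          rcases hi.eq_or_lt with rfl | hi
          · rw [skewCoeff_mul_eq hmem hu fun i i' hi _ _ => hcf i hi, skewCoeff_ml_mul_tau_pow,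
              Finsupp.single_eq_same, div_mul_cancel₀, sub_self]
            exact pow_ne_zero _ (skewCoeff_skewDeg_ne_zero hu hu0)
          · rw [h i hi, skewCoeff_mul_eq_zero hmem hu, sub_self]
            intro i' l hi' hl
            have := hcf i' hi'
            have := le_skewDeg hl
            omega
      refine ⟨a + ml k c * τ ^ j, add_mem ha hmem, b, hb, ?_, hb'⟩
      rw [add_mul, add_right_comm, ← hab, sub_add_cancel]

/-- `k{τ} / k{τ}u` is finite. -/
theorem exists_sub_eq_mul {u : 𝓔} (hu : u ∈ 𝓡) (hu0 : u ≠ 0) (f : ℕ → 𝓔) (hf : ∀ i, f i ∈ 𝓡) :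
    ∃ i j, i < j ∧ ∃ a ∈ 𝓡, f j - f i = a * u := by
  have h := fun i => exists_eq_mul_add hu hu0 (hf i)
  choose a ha b hb hab hb0 using h
  obtain ⟨i, j, hij, he⟩ := Finite.exists_ne_map_eq_of_infinite
    (fun (i : ℕ) (l : Fin (deg u)) => cf (b i) l)
  have hbb : b i = b j := by
    rw [← ofCoeffs_skewCoeff (hb i), ← ofCoeffs_skewCoeff (hb j)]
    congr 1
    ext l
    by_cases hl : l < deg u
    · exact congrFun he ⟨l, hl⟩
    · rw [hb0 i l (not_lt.1 hl), hb0 j l (not_lt.1 hl)]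
  wlog hlt : i < j generalizing i j
  · exact this j i hij.symm he.symm hbb.symm (by omega)
  · refine ⟨i, j, hlt, a j - a i, sub_mem (ha j) (ha i), ?_⟩
    rw [hab i, hab j, hbb, add_sub_add_right_eq_sub, sub_mul]

theorem card_le_of_skew_eq_zero {b : 𝓔} (hb : b ∈ 𝓡) (hb0 : b ≠ 0) (s : Finset (Kb k))
    (hs : ∀ x ∈ s, b x = 0) : s.card ≤ 𝔮 ^ deg b := by
  refine card_le_of_ofCoeffs_eq_zero (hFq := hFq) (c := cf b)
    (mt (skewCoeff_eq_zero_iff hb).1 hb0) (fun i hi => skewCoeff_eq_zero_of_skewDeg_lt hi) s ?_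
  rwa [ofCoeffs_skewCoeff hb]

theorem eq_zero_of_skew_eq_zero {b : 𝓔} (hb : b ∈ 𝓡) {D : ℕ} (hD : ∀ i, D ≤ i → cf b i = 0)
    (s : Finset (Kb k)) (hcard : 𝔮 ^ D ≤ s.card) (hs : ∀ x ∈ s, b x = 0) : b = 0 := by
  by_contra hb0
  have h1 := card_le_of_skew_eq_zero hb hb0 s hs
  have h2 : deg b < D := by
    by_contra h
    exact skewCoeff_skewDeg_ne_zero hb hb0 (hD _ (not_lt.1 h))
  exact absurd (Nat.pow_lt_pow_right (one_lt_card_base (Fq := Fq)) h2) (not_lt.2 (hcard.trans h1))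

section LeftIdeals

theorem leftSpan_le {I : Set 𝓔} (hI : I ⊆ 𝓡) : (leftSpan p m Fq k hFq I : Set 𝓔) ⊆ 𝓡 := by
  have : leftSpan p m Fq k hFq I ≤ (𝓡).toAddSubgroup := by
    refine (AddSubgroup.closure_le _).2 ?_
    rintro _ ⟨w, hw, x, hx, rfl⟩
    exact (𝓡).mul_mem hw (hI hx)
  exact this

theorem mul_mem_leftSpan {I : Set 𝓔} {w y : 𝓔} (hw : w ∈ 𝓡) (hy : y ∈ leftSpan p m Fq k hFq I) :
    w * y ∈ leftSpan p m Fq k hFq I := by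
  have : leftSpan p m Fq k hFq I ≤ (leftSpan p m Fq k hFq I).comap (AddMonoidHom.mulLeft w) := by
    refine (AddSubgroup.closure_le _).2 ?_
    rintro _ ⟨v, hv, x, hx, rfl⟩
    exact AddSubgroup.subset_closure ⟨w * v, mul_mem hw hv, x, hx, (mul_assoc _ _ _).symm⟩
  exact this hy

theorem subset_leftSpan (I : Set 𝓔) : I ⊆ leftSpan p m Fq k hFq I := fun x hx =>
  AddSubgroup.subset_closure ⟨1, one_mem _, x, hx, (one_mul x).symm⟩

/-- Left ideals of `k{τ}` are principal. -/
theorem exists_isIdealGen {I : Set 𝓔} (hI : I ⊆ 𝓡) (h0 : ∃ x ∈ I, x ≠ 0) :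
    ∃ u, u ≠ 0 ∧ IsIdealGen p m Fq k hFq I u := by
  obtain ⟨x, hx, hx0⟩ := h0
  have hne : ∃ d, ∃ u ∈ leftSpan p m Fq k hFq I, u ≠ 0 ∧ deg u = d :=
    ⟨_, x, subset_leftSpan I hx, hx0, rfl⟩
  classical
  obtain ⟨u, hu, hu0, hd⟩ := Nat.find_spec hne
  have huR : u ∈ 𝓡 := leftSpan_le hI hu
  refine ⟨u, hu0, huR, Set.ext fun y => ⟨fun hy => ?_, ?_⟩⟩
  · obtain ⟨a, ha, b, hb, hab, hb'⟩ := exists_eq_mul_add huR hu0 (leftSpan_le hI hy)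
    have hbmem : b ∈ leftSpan p m Fq k hFq I := by
      rw [show b = y - a * u by rw [hab, add_sub_cancel_left]]
      exact sub_mem hy (mul_mem_leftSpan ha hu)
    have hb0 : b = 0 := by
      by_contra hb0
      have h1 := Nat.find_min' hne ⟨b, hbmem, hb0, rfl⟩
      rw [← hd] at h1
      exact skewCoeff_skewDeg_ne_zero hb hb0 (hb' _ h1)
    exact ⟨a, ha, by rw [hab, hb0, add_zero]⟩
  · rintro ⟨w, hw, rfl⟩
    exact mul_mem_leftSpan hw hu

/-- Two generators of the same left ideal differ by an element of `kˣ`. -/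
theorem exists_eq_ml_mul {u v a b : 𝓔} (hv : v ∈ 𝓡) (ha : a ∈ 𝓡) (hb : b ∈ 𝓡)
    (hv0 : v ≠ 0) (h1 : u = a * v) (h2 : v = b * u) : ∃ c : k, c ≠ 0 ∧ u = ml k c * v := by
  have hba : b * a = 1 := by
    refine skew_mul_right_cancel hv (mul_mem hb ha) (one_mem _) hv0 ?_
    rw [mul_assoc, ← h1, ← h2, one_mul]
  have h10 : (1 : 𝓔) ≠ 0 := by simpa using tau_pow_ne_zero (hFq := hFq) 0
  have ha0 : a ≠ 0 := by
    rintro rfl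
    rw [mul_zero] at hba
    exact h10 hba.symm
  have hb0 : b ≠ 0 := by
    rintro rfl
    rw [zero_mul] at hba
    exact h10 hba.symm
  have hdeg := skewDeg_mul hb ha hb0 ha0
  rw [hba, ← ml_one, skewDeg_ml] at hdeg
  have := eq_ml_of_skewDeg_eq_zero ha (by omega)
  refine ⟨cf a 0, ?_, by rw [← this, h1]⟩
  intro h
  rw [h, ml_zero] at this
  exact ha0 this

theorem exists_finset_ker_tau_pow_sub_one {M : ℕ} (hM : M ≠ 0) :
    ∃ S : Finset (Kb k), (∀ x, x ∈ S ↔ (τ ^ M - 1) x = 0) ∧ S.card = 𝔮 ^ M := by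
  classical
  have : CharP (Kb k) p := charP_of_injective_algebraMap (algebraMap k (Kb k)).injective p
  have hq : 1 < 𝔮 ^ M := Nat.one_lt_pow hM one_lt_card_base
  let f : (Kb k)[X] := X ^ 𝔮 ^ M - X
  have hf0 : f ≠ 0 := FiniteField.X_pow_card_sub_X_ne_zero _ hq
  have hdeg : f.natDegree = 𝔮 ^ M := FiniteField.X_pow_card_sub_X_natDegree_eq _ hq
  have hsep : f.Separable := by
    refine galois_poly_separable p _ ?_
    have hm : m ≠ 0 := by
      rintro rfl
      have := one_lt_card_base (Fq := Fq)
      rw [hFq, pow_zero] at this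
      exact lt_irrefl _ this
    rw [hFq]
    exact dvd_pow (dvd_pow_self p hm) hM
  refine ⟨f.roots.toFinset, fun x => ?_, ?_⟩
  · have h1 : (τ ^ M - 1) x = x ^ 𝔮 ^ M - x := by
      rw [← tau_pow_apply (hFq := hFq)]; rfl
    rw [h1, Multiset.mem_toFinset, mem_roots hf0, IsRoot.def]
    simp [f]
  · rw [Multiset.toFinset_card_of_nodup (nodup_roots hsep), ← hdeg]
    exact (splits_iff_card_roots.1 (IsAlgClosed.splits f))

theorem skew_tau_pow_sub_one {M : ℕ} (hM : M ≠ 0) :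
    τ ^ M - 1 ∈ 𝓡 ∧ τ ^ M - 1 ≠ 0 ∧ deg (τ ^ M - 1) = M ∧ ord (τ ^ M - 1) = 0 := by
  have hR : τ ^ M - 1 ∈ 𝓡 := sub_mem (pow_mem tau_mem _) (one_mem _)
  have hcf : cf (τ ^ M - 1) = Finsupp.single M 1 - Finsupp.single 0 1 := by
    rw [skewCoeff_sub (pow_mem tau_mem _) (one_mem _), skewCoeff_tau_pow]
    conv_lhs => rw [← ml_one, skewCoeff_ml]
  have h1 : cf (τ ^ M - 1) M ≠ 0 := by rw [hcf]; simp [hM]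
  have h0 : cf (τ ^ M - 1) 0 ≠ 0 := by rw [hcf]; simp [hM]
  refine ⟨hR, ?_, skewDeg_eq h1 fun j hj => ?_, skewOrd_eq h0 fun j hj => by omega⟩
  · intro h
    rw [h, skewCoeff_zero] at h1
    exact h1 rfl
  · rw [hcf, Finsupp.sub_apply, Finsupp.single_eq_of_ne (by omega),
      Finsupp.single_eq_of_ne (by omega), sub_zero]

/-- If `u` is a right divisor of a separable `z`, then every element vanishing on the kernel of `u`
is right divisible by `u`. -/
theorem exists_eq_mul_of_ker_le {z u v : 𝓔} (hu : u ∈ 𝓡) (hv : v ∈ 𝓡) (hz0 : z ≠ 0)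
    (hz : z = v * u) (S : Finset (Kb k)) (hS : ∀ x, x ∈ S ↔ z x = 0) (hcard : S.card = 𝔮 ^ deg z)
    {e : 𝓔} (he : e ∈ 𝓡) (hker : ∀ x, u x = 0 → e x = 0) : ∃ a ∈ 𝓡, e = a * u := by
  classical
  have hu0 : u ≠ 0 := by rintro rfl; exact hz0 (by rw [hz, mul_zero])
  have hv0 : v ≠ 0 := by rintro rfl; exact hz0 (by rw [hz, zero_mul])
  have hK : ∀ x, x ∈ S.filter (fun x => u x = 0) ↔ u x = 0 := fun x => by
    rw [Finset.mem_filter, hS, and_iff_right_iff_imp]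
    intro hx
    rw [hz, end_mul_apply, hx, map_zero]
  have h1 : S.card ≤ (S.filter fun x => u x = 0).card * (S.image u).card := by
    refine Finset.card_le_mul_card_image _ _ fun b hb => ?_
    obtain ⟨x₀, -, rfl⟩ := Finset.mem_image.1 hb
    refine Finset.card_le_card_of_injOn (fun x => x - x₀) (fun x hx => ?_) fun x _ y _ hxy => ?_
    · have hx := Finset.mem_filter.1 hx
      exact Finset.mem_coe.2 ((hK _).2 (by rw [map_sub, hx.2, sub_self]))
    · exact sub_left_injective hxy
  have h2 : (S.image u).card ≤ 𝔮 ^ deg v := by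
    refine card_le_of_skew_eq_zero hv hv0 _ fun y hy => ?_
    obtain ⟨x, hx, rfl⟩ := Finset.mem_image.1 hy
    rw [← end_mul_apply, ← hz]
    exact (hS x).1 hx
  have h3 : 𝔮 ^ deg u ≤ (S.filter fun x => u x = 0).card := by
    rw [hcard, hz, skewDeg_mul hv hu hv0 hu0, pow_add, mul_comm] at h1
    exact Nat.le_of_mul_le_mul_right (h1.trans (Nat.mul_le_mul_left _ h2))
      (pow_pos (zero_lt_one.trans one_lt_card_base) _)
  obtain ⟨a, ha, b, hb, hab, hb'⟩ := exists_eq_mul_add hu hu0 he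
  refine ⟨a, ha, ?_⟩
  rw [hab, eq_zero_of_skew_eq_zero hb hb' _ h3, add_zero]
  intro x hx
  have hx := (hK x).1 hx
  have := hker x hx
  rw [hab, end_add_apply, end_mul_apply, hx, map_zero, zero_add] at this
  exact this

variable {n : ℕ}

theorem card_base_pos (hk : Fintype.card k = 𝔮 ^ n) : n ≠ 0 := by
  rintro rfl
  have : 1 < Fintype.card k := Fintype.one_lt_card
  rw [hk, pow_zero] at this
  exact lt_irrefl _ this

theorem pow_card_base (hk : Fintype.card k = 𝔮 ^ n) (c : k) (j : ℕ) : c ^ 𝔮 ^ (n * j) = c := by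
  rw [pow_mul, ← hk, FiniteField.pow_card_pow]

theorem frob_comm (hk : Fintype.card k = 𝔮 ^ n) (j : ℕ) {w : 𝓔} (hw : w ∈ 𝓡) :
    τ ^ (n * j) * w = w * τ ^ (n * j) := by
  have : 𝓡 ≤ Subring.centralizer {τ ^ (n * j)} := by
    refine Subring.closure_le.2 (Set.insert_subset ?_ ?_)
    · refine Subring.mem_centralizer_iff.2 fun g hg => ?_
      rw [Set.mem_singleton_iff.1 hg, pow_mul_comm']
    · rintro _ ⟨a, rfl⟩
      refine Subring.mem_centralizer_iff.2 fun g hg => ?_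
      rw [Set.mem_singleton_iff.1 hg, tau_pow_mul_ml, pow_card_base hk]
  exact Subring.mem_centralizer_iff.1 (this hw) _ rfl

theorem exists_frob_pow_sub_one_eq (hk : Fintype.card k = 𝔮 ^ n) {w : 𝓔} (hw : w ∈ 𝓡)
    (hw0 : cf w 0 ≠ 0) : ∃ N ≠ 0, ∃ v ∈ 𝓡, τ ^ (n * N) - 1 = v * w := by
  have hw1 : w ≠ 0 := by
    rintro rfl
    rw [skewCoeff_zero] at hw0
    exact hw0 rfl
  have hn := card_base_pos (Fq := Fq) hk
  obtain ⟨i, j, hij, a, ha, h⟩ := exists_sub_eq_mul hw hw1 (fun i => τ ^ (n * i))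
    fun i => pow_mem tau_mem _
  obtain ⟨N, rfl⟩ := Nat.exists_eq_add_of_lt hij
  obtain ⟨h1, h2, -, h3⟩ := skew_tau_pow_sub_one (k := k) (hFq := hFq)
    (mul_ne_zero hn (Nat.succ_ne_zero N))
  have hfac : a * w = (τ ^ (n * (N + 1)) - 1) * τ ^ (n * i) := by
    rw [← h, sub_mul, one_mul, ← pow_add]
    congr 2
    ring
  have hne : a * w ≠ 0 := by
    rw [hfac]
    exact skew_mul_ne_zero h1 (pow_mem tau_mem _) h2 (tau_pow_ne_zero _)
  have ha0 : a ≠ 0 := by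
    rintro rfl
    exact hne (zero_mul _)
  have hord := skewOrd_mul ha hw ha0 hw1
  rw [hfac, skewOrd_mul h1 (pow_mem tau_mem _) h2 (tau_pow_ne_zero _), h3, skewOrd_tau_pow,
    skewOrd_eq hw0 fun j hj => absurd hj (Nat.not_lt_zero j)] at hord
  obtain ⟨v, hv, rfl⟩ := exists_eq_mul_tau_pow ha (n * i) fun l hl => by
    by_contra hne
    have := skewOrd_le hne
    omega
  refine ⟨N + 1, Nat.succ_ne_zero N, v, hv, ?_⟩
  refine skew_mul_right_cancel (pow_mem tau_mem (n * i)) h1 (mul_mem hv hw) (tau_pow_ne_zero _) ?_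
  rw [← hfac, mul_assoc, mul_assoc, frob_comm hk i hw]

end LeftIdeals

section Center

variable {n : ℕ} {γ : Fq[X] →+* k} {r : ℕ}

theorem gamma_C_pow (c : Fq) (i : ℕ) : γ (C c) ^ 𝔮 ^ i = γ (C c) := by
  rw [← map_pow, ← map_pow, FiniteField.pow_card_pow]

theorem ml_gamma_C_comm (c : Fq) {w : 𝓔} (hw : w ∈ 𝓡) :
    ml k (γ (C c)) * w = w * ml k (γ (C c)) := by
  have : 𝓡 ≤ Subring.centralizer {ml k (γ (C c))} := by
    refine Subring.closure_le.2 (Set.insert_subset ?_ ?_)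
    · refine Subring.mem_centralizer_iff.2 fun g hg => ?_
      have := tau_pow_mul_ml (hFq := hFq) 1 (γ (C c))
      rw [gamma_C_pow, pow_one] at this
      rw [Set.mem_singleton_iff.1 hg, this]
    · rintro _ ⟨a, rfl⟩
      refine Subring.mem_centralizer_iff.2 fun g hg => ?_
      rw [Set.mem_singleton_iff.1 hg, ← ml_mul, ← ml_mul, mul_comm]
  exact Subring.mem_centralizer_iff.1 (this hw) _ rfl

theorem frob_comm' (hk : Fintype.card k = 𝔮 ^ n) {w : 𝓔} (hw : w ∈ 𝓡) :
    τ ^ n * w = w * τ ^ n := by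
  simpa using frob_comm hk 1 hw

variable (hFq n) in
/-- The structure map of `k{τ}` as an algebra over the central subring `Fq[π]`. -/
def zHom (γ : Fq[X] →+* k) : Fq[X] →+* skewPoly p m Fq k hFq :=
  eval₂RingHom' (((mlHom k).codRestrict (skewPoly p m Fq k hFq) ml_mem).comp (γ.comp C))
    ⟨tau p m Fq k hFq ^ n, pow_mem tau_mem n⟩
    fun c => Subtype.ext (ml_gamma_C_comm c (pow_mem tau_mem n))

theorem zHom_C (c : Fq) :
    (zHom hFq n γ (C c) : 𝓔) = ml k (γ (C c)) := by
  simp [zHom, eval₂RingHom']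
  rfl

theorem zHom_X : (zHom hFq n γ X : 𝓔) = τ ^ n := by
  simp [zHom, eval₂RingHom']

theorem zHom_comm (hk : Fintype.card k = 𝔮 ^ n) (g : Fq[X]) (w : 𝓡) :
    zHom hFq n γ g * w = w * zHom hFq n γ g := by
  induction g using Polynomial.induction_on' with
  | add f g hf hg => rw [map_add, add_mul, mul_add, hf, hg]
  | monomial i a =>
    rw [← C_mul_X_pow_eq_monomial, map_mul, map_pow]
    have h1 : Commute (zHom hFq n γ (C a)) w :=
      Subtype.ext (by simpa [zHom_C] using ml_gamma_C_comm a w.2)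
    have h2 : Commute (zHom hFq n γ X) w :=
      Subtype.ext (by simpa [zHom_X] using frob_comm' hk w.2)
    exact h1.mul_left (h2.pow_left i)

variable (hFq) in
/-- `k{τ}` as an algebra over `Fq[π]`. -/
abbrev zAlgebra (hk : Fintype.card k = 𝔮 ^ n) (γ : Fq[X] →+* k) :
    Algebra Fq[X] (skewPoly p m Fq k hFq) :=
  (zHom hFq n γ).toAlgebra' (zHom_comm hk)

theorem zHom_monomial_mul (hk : Fintype.card k = 𝔮 ^ n) (i : ℕ) (a : Fq) (c : k) (j : ℕ) :
    (zHom hFq n γ (monomial i a) : 𝓔) * (ml k c * τ ^ j) =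
      ml k (γ (C a) * c) * τ ^ (n * i + j) := by
  rw [← C_mul_X_pow_eq_monomial, map_mul, map_pow, Subring.coe_mul, zHom_C, Subring.coe_pow,
    zHom_X, ← pow_mul, mul_assoc, ← mul_assoc (τ ^ (n * i)), frob_comm hk i (ml_mem c),
    ml_mul, pow_add]
  simp only [mul_assoc]

theorem skewCoeff_zHom_mul (hk : Fintype.card k = 𝔮 ^ n) (g : Fq[X]) (c : k) {j j' : ℕ}
    (hj : j < n) (hj' : j' < n) (l : ℕ) :
    cf ((zHom hFq n γ g : 𝓔) * (ml k c * τ ^ j)) (n * l + j') =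
      if j = j' then γ (C (g.coeff l)) * c else 0 := by
  have hmem : ml k c * τ ^ j ∈ 𝓡 := mul_mem (ml_mem c) (pow_mem tau_mem j)
  induction g using Polynomial.induction_on' with
  | add f g hf hg =>
    rw [map_add (zHom hFq n γ), Subring.coe_add, add_mul, skewCoeff_add (mul_mem (Subtype.prop _) hmem)
      (mul_mem (Subtype.prop _) hmem), Finsupp.add_apply, hf, hg]
    split_ifs
    · rw [coeff_add, C_add, map_add, add_mul]
    · rw [add_zero]
  | monomial i a =>
    rw [zHom_monomial_mul hk, skewCoeff_ml_mul_tau_pow, Finsupp.single_apply, coeff_monomial]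
    have key : n * i + j = n * l + j' ↔ i = l ∧ j = j' := by
      constructor
      · intro h
        have h1 := congrArg (· / n) h
        simp only [Nat.mul_add_div (show 0 < n by omega), Nat.div_eq_of_lt hj,
          Nat.div_eq_of_lt hj', add_zero] at h1
        subst h1
        exact ⟨rfl, by omega⟩
      · rintro ⟨rfl, rfl⟩; rfl
    simp only [key]
    split_ifs <;> simp_all

theorem skewCoeff_sum {ι : Type*} (s : Finset ι) (f : ι → 𝓔) (hf : ∀ i, f i ∈ 𝓡) (l : ℕ) :
    cf (∑ i ∈ s, f i) l = ∑ i ∈ s, cf (f i) l := by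
  classical
  induction s using Finset.induction_on with
  | empty => simp [skewCoeff_zero]
  | insert a s ha ih =>
    rw [Finset.sum_insert ha, Finset.sum_insert ha,
      skewCoeff_add (hf a) (Subring.sum_mem _ fun i _ => hf i), Finsupp.add_apply, ih]

theorem zHom_injective (hk : Fintype.card k = 𝔮 ^ n) :
    Function.Injective (zHom hFq n γ) := by
  refine (injective_iff_map_eq_zero _).2 fun g hg => ?_
  have hn := card_base_pos (Fq := Fq) hk
  ext l
  have := skewCoeff_zHom_mul (hFq := hFq) (γ := γ) hk g 1 (Nat.pos_of_ne_zero hn)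
    (Nat.pos_of_ne_zero hn) l
  rw [hg, Subring.coe_zero, zero_mul, skewCoeff_zero, if_pos rfl, mul_one, Finsupp.zero_apply]
    at this
  exact (map_eq_zero (γ.comp C)).1 this.symm

theorem zAlgebra_isTorsionFree (hk : Fintype.card k = 𝔮 ^ n) (γ : Fq[X] →+* k) :
    letI := zAlgebra hFq hk γ
    Module.IsTorsionFree Fq[X] 𝓡 := by
  let _ := zAlgebra hFq hk γ
  rw [Module.isTorsionFree_iff_smul_eq_zero]
  intro g x h
  rw [Algebra.smul_def, mul_eq_zero] at h
  exact h.imp_left fun h => zHom_injective hk (h.trans (map_zero _).symm)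

theorem zAlgebra_finite (hk : Fintype.card k = 𝔮 ^ n) (γ : Fq[X] →+* k) :
    letI := zAlgebra hFq hk γ
    Module.Finite Fq[X] 𝓡 := by
  let _ := zAlgebra hFq hk γ
  have hn := card_base_pos (Fq := Fq) hk
  let f : k × Fin n → 𝓡 := fun x =>
    ⟨ml k x.1 * τ ^ (x.2 : ℕ), mul_mem (ml_mem _) (pow_mem tau_mem _)⟩
  classical
  refine ⟨⟨Finset.univ.image f, ?_⟩⟩
  rw [Finset.coe_image, Finset.coe_univ, Set.image_univ, eq_top_iff]
  rintro ⟨w, hw⟩ -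
  obtain ⟨c, rfl⟩ := (mem_skewPoly_iff w).1 hw
  have hsum : (⟨ofC c, hw⟩ : 𝓡) = ∑ i ∈ c.support,
      ⟨ml k (c i) * τ ^ i, mul_mem (ml_mem _) (pow_mem tau_mem _)⟩ := by
    apply Subtype.ext
    rw [AddSubmonoidClass.coe_finsetSum]
    rfl
  rw [hsum]
  refine Submodule.sum_mem _ fun i _ => ?_
  have : (⟨ml k (c i) * τ ^ i, mul_mem (ml_mem _) (pow_mem tau_mem _)⟩ : 𝓡) =
      (monomial (i / n) (1 : Fq)) • f (c i, ⟨i % n, Nat.mod_lt _ (Nat.pos_of_ne_zero hn)⟩) := by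
    apply Subtype.ext
    rw [Algebra.smul_def]
    refine Eq.trans ?_ (zHom_monomial_mul hk _ _ _ _).symm
    rw [Nat.div_add_mod, C_1, map_one, one_mul]
  rw [this]
  exact Submodule.smul_mem _ _ (Submodule.subset_span ⟨_, rfl⟩)

theorem sq_le_finrank (hk : Fintype.card k = 𝔮 ^ n) (γ : Fq[X] →+* k) :
    letI := zAlgebra hFq hk γ
    n ^ 2 ≤ Module.finrank Fq[X] 𝓡 := by
  let _ := zAlgebra hFq hk γ
  have := zAlgebra_finite (hFq := hFq) hk γ
  let _ : Algebra Fq k := (γ.comp C).toAlgebra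
  have hfr : Module.finrank Fq k = n := by
    have := Module.card_eq_pow_finrank (K := Fq) (V := k)
    rw [hk] at this
    exact (Nat.pow_right_injective (one_lt_card_base (Fq := Fq)) this).symm
  let b : Module.Basis (Fin n) Fq k := Module.finBasisOfFinrankEq Fq k hfr
  let f : Fin n × Fin n → 𝓡 := fun x =>
    ⟨ml k (b x.1) * τ ^ (x.2 : ℕ), mul_mem (ml_mem _) (pow_mem tau_mem _)⟩
  have hli : LinearIndependent Fq[X] f := by
    rw [Fintype.linearIndependent_iff]
    rintro g hg ⟨i₀, j₀⟩
    ext l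
    have h1 : cf ((∑ x, g x • f x : 𝓡) : 𝓔) (n * l + j₀) = 0 := by
      rw [hg, Subring.coe_zero, skewCoeff_zero]; rfl
    rw [AddSubmonoidClass.coe_finsetSum, skewCoeff_sum _ _ fun i => Subtype.prop _,
      Fintype.sum_prod_type] at h1
    have h2 : ∑ i, (g (i, j₀)).coeff l • b i = 0 := by
      rw [← h1]
      refine Finset.sum_congr rfl fun i _ => ?_
      have h3 : ∀ j : Fin n, cf ((g (i, j) • f (i, j) : 𝓡) : 𝓔) (n * l + j₀) =
          if j = j₀ then γ (C ((g (i, j)).coeff l)) * b i else 0 := fun j => by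
        rw [Algebra.smul_def]
        refine (skewCoeff_zHom_mul hk (g (i, j)) (b i) j.2 j₀.2 l).trans ?_
        simp only [Fin.ext_iff]
      simp only [h3, Finset.sum_ite_eq', Finset.mem_univ, if_true]
      rw [Algebra.smul_def]; rfl
    exact Fintype.linearIndependent_iff.1 b.linearIndependent _ h2 i₀
  have := hli.fintype_card_le_finrank
  simpa [sq] using this

end Center

section Modules

variable {n : ℕ} {γ : Fq[X] →+* k} {r : ℕ} (φ : DrinfeldModule p m Fq k hFq γ r)

theorem DrinfeldModule.mem (a : Fq[X]) : φ.toRingHom a ∈ 𝓡 := by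
  rw [φ.eq_ofCoeffs]
  exact ofCoeffs_mem _

theorem DrinfeldModule.skewCoeff_eq (a : Fq[X]) : cf (φ.toRingHom a) = φ.coeffs a := by
  rw [φ.eq_ofCoeffs, skewCoeff_ofCoeffs]

theorem DrinfeldModule.skewDeg_eq {a : Fq[X]} (ha : a ≠ 0) :
    deg (φ.toRingHom a) = r * a.natDegree := by
  refine Drinfeld.skewDeg_eq ?_ fun j hj => ?_
  · rw [φ.skewCoeff_eq]
    exact φ.coeff_top a ha
  · rw [φ.skewCoeff_eq]
    exact φ.coeff_eq_zero a j hj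

theorem DrinfeldModule.ne_zero {a : Fq[X]} (ha : a ≠ 0) : φ.toRingHom a ≠ 0 := by
  intro h
  have := φ.coeff_top a ha
  rw [← φ.skewCoeff_eq, h, skewCoeff_zero] at this
  exact this rfl

theorem DrinfeldModule.apply_C (c : Fq) : φ.toRingHom (C c) = ml k (γ (C c)) := by
  rw [← ofCoeffs_skewCoeff (φ.mem (C c)), φ.skewCoeff_eq]
  have : φ.coeffs (C c) = Finsupp.single 0 (γ (C c)) := by
    ext i
    by_cases hi : i = 0
    · rw [hi, Finsupp.single_eq_same, φ.coeff_zero]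
    · rw [Finsupp.single_eq_of_ne hi]
      refine φ.coeff_eq_zero _ _ ?_
      rw [natDegree_C]
      omega
  rw [this, ofCoeffs_single]
  simp

theorem DrinfeldModule.comm (a b : Fq[X]) :
    φ.toRingHom a * φ.toRingHom b = φ.toRingHom b * φ.toRingHom a := by
  rw [← map_mul, mul_comm, map_mul]

theorem DrinfeldModule.mem_endRing (a : Fq[X]) :
    φ.toRingHom a ∈ EndRing p m Fq k hFq φ := by
  refine ⟨φ.mem a, Subring.mem_centralizer_iff.2 ?_⟩
  rintro _ ⟨b, rfl⟩
  exact φ.comm b a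

theorem DrinfeldModule.frob_mem_endRing (hk : Fintype.card k = 𝔮 ^ n) (j : ℕ) :
    τ ^ (n * j) ∈ EndRing p m Fq k hFq φ := by
  refine ⟨pow_mem tau_mem _, Subring.mem_centralizer_iff.2 ?_⟩
  rintro _ ⟨b, rfl⟩
  exact (frob_comm hk j (φ.mem b)).symm

theorem mul_apply_eq_of_apply_X {ψ : DrinfeldModule p m Fq k hFq γ r} {u : 𝓔} (hu : u ∈ 𝓡)
    (h : u * φ.toRingHom X = ψ.toRingHom X * u) (a : Fq[X]) :
    u * φ.toRingHom a = ψ.toRingHom a * u := by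
  induction a using Polynomial.induction_on' with
  | add f g hf hg => rw [map_add, map_add, mul_add, add_mul, hf, hg]
  | monomial i a =>
    rw [← C_mul_X_pow_eq_monomial, map_mul, map_mul, map_pow, map_pow, φ.apply_C, ψ.apply_C,
      ← mul_assoc, ← ml_gamma_C_comm a hu, mul_assoc, mul_assoc]
    congr 1
    exact SemiconjBy.pow_right (show SemiconjBy u _ _ from h) i

theorem mem_endRing_of_comm {w : 𝓔} (hw : w ∈ 𝓡)
    (h : w * φ.toRingHom X = φ.toRingHom X * w) : w ∈ EndRing p m Fq k hFq φ := by
  refine ⟨hw, Subring.mem_centralizer_iff.2 ?_⟩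
  rintro _ ⟨b, rfl⟩
  exact (mul_apply_eq_of_apply_X φ hw h b).symm

theorem exists_endRing_model (hk : Fintype.card k = 𝔮 ^ n)
    (hE : EndRing p m Fq k hFq φ = ApirOp p m Fq k hFq n φ) :
    letI := zAlgebra hFq hk γ
    ∃ (E : Type) (_ : CommRing E) (_ : Nontrivial E) (_ : Algebra Fq[X] E)
      (ι : E →ₐ[Fq[X]] 𝓡) (pb : PowerBasis Fq[X] E), Function.Injective ι ∧
      (∀ w : 𝓔, w ∈ EndRing p m Fq k hFq φ ↔ ∃ e, (ι e : 𝓔) = w) ∧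
      (∀ (z : Fq[X]) (x : 𝓡), z ≠ 0 → z • x ∈ Set.range ι → x ∈ Set.range ι) ∧
      n ≤ pb.dim := by
  let _ := zAlgebra hFq hk γ
  have := zAlgebra_finite (hFq := hFq) hk γ
  have := zAlgebra_isTorsionFree (hFq := hFq) hk γ
  let T : 𝓡 := ⟨φ.toRingHom X, φ.mem X⟩
  have hTT : ∀ a ∈ ({T} : Set 𝓡), ∀ b ∈ ({T} : Set 𝓡), a * b = b * a := by
    rintro a rfl b rfl; rfl
  let S : Subalgebra Fq[X] 𝓡 := Algebra.adjoin Fq[X] {T}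
  let _ : CommRing S :=
    { (inferInstance : Ring S) with
      mul_comm := (Algebra.isMulCommutative_adjoin Fq[X] hTT).is_comm.comm }
  have hTS : T ∈ S := Algebra.subset_adjoin rfl
  let t : S := ⟨T, hTS⟩
  have hfin : Module.Finite Fq[X] S := inferInstanceAs (Module.Finite Fq[X] (Subalgebra.toSubmodule S))
  have htop : Algebra.adjoin Fq[X] {t} = ⊤ := by
    have := Algebra.adjoin_adjoin_coe_preimage (R := Fq[X]) (s := {T})
    convert! this
    ext x
    exact Subtype.ext_iff
  have hdom : IsDomain S := inferInstance
  have htf : Module.IsTorsionFree Fq[X] S := inferInstance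
  let pb : PowerBasis Fq[X] S := PowerBasis.ofAdjoinEqTop' (IsIntegral.of_finite _ t) htop
  have hmem : ∀ w : 𝓡, (w : 𝓔) ∈ EndRing p m Fq k hFq φ ↔ w ∈ S := by
    intro w
    constructor
    · intro h
      rw [hE] at h
      have hle : ApirOp p m Fq k hFq n φ ≤ S.toSubring.map (𝓡).subtype := by
        refine Subring.closure_le.2 (Set.insert_subset ?_ ?_)
        · exact ⟨algebraMap Fq[X] 𝓡 X, S.algebraMap_mem _, zHom_X⟩
        · rintro _ ⟨a, rfl⟩
          induction a using Polynomial.induction_on' with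
          | add f g hf hg =>
            rw [map_add]
            exact add_mem hf hg
          | monomial i a =>
            rw [← C_mul_X_pow_eq_monomial, map_mul, map_pow, φ.apply_C]
            have hT : φ.toRingHom X ∈ S.toSubring.map (𝓡).subtype := ⟨T, hTS, rfl⟩
            exact mul_mem ⟨algebraMap Fq[X] 𝓡 (C a), S.algebraMap_mem _, zHom_C a⟩
              (pow_mem hT _)
      obtain ⟨w', hw', h'⟩ := hle h
      rwa [← Subtype.ext h' (p := (· ∈ 𝓡))]
    · intro h
      refine mem_endRing_of_comm φ w.2 ?_
      have hle : S ≤ Subalgebra.centralizer Fq[X] {T} := by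
        refine Algebra.adjoin_le ?_
        rintro _ rfl
        exact (Subalgebra.mem_centralizer_iff Fq[X]).2 (by rintro _ rfl; rfl)
      have := (Subalgebra.mem_centralizer_iff Fq[X]).1 (hle h) T rfl
      exact (congrArg Subtype.val this).symm
  have hcomm : ∀ x : 𝓡, x * T = T * x → x ∈ S := fun x hx =>
    (hmem x).1 (mem_endRing_of_comm φ x.2 (congrArg Subtype.val hx))
  refine ⟨S, inferInstance, inferInstance, inferInstance, S.val, pb, Subtype.val_injective,
    fun w => ?_, ?_, ?_⟩
  · constructor
    · intro h
      exact ⟨⟨⟨w, h.1⟩, (hmem ⟨w, h.1⟩).1 h⟩, rfl⟩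
    · rintro ⟨e, rfl⟩
      exact (hmem _).2 e.2
  · rintro z x hz ⟨e, he⟩
    refine ⟨⟨x, hcomm x ?_⟩, rfl⟩
    have h1 : e * t = t * e := mul_comm _ _
    have h2 := congrArg S.val h1
    rw [map_mul, map_mul, he] at h2
    change z • x * T = T * (z • x) at h2
    rw [smul_mul_assoc, mul_smul_comm] at h2
    exact smul_right_injective _ hz h2
  · have h1 := finrank_le_sq S.val Subtype.val_injective fun x hx => ⟨⟨x, hcomm x (hx t)⟩, rfl⟩
    rw [pb.finrank] at h1
    exact (Nat.pow_le_pow_iff_left two_ne_zero).1 ((sq_le_finrank (hFq := hFq) hk γ).trans h1)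

end Modules

theorem exists_mul_eq_of_mem_leftSpan {I : Set 𝓔} {x v z : 𝓔}
    (h : ∀ i ∈ I, ∃ b ∈ 𝓡, i * x = b * v) (hz : z ∈ leftSpan p m Fq k hFq I) :
    ∃ b ∈ 𝓡, z * x = b * v := by
  induction hz using AddSubgroup.closure_induction with
  | mem z hz =>
    obtain ⟨a, ha, i, hi, rfl⟩ := hz
    obtain ⟨b, hb, hbi⟩ := h i hi
    exact ⟨a * b, mul_mem ha hb, by rw [mul_assoc, hbi, mul_assoc]⟩
  | zero => exact ⟨0, zero_mem _, by rw [zero_mul, zero_mul]⟩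
  | add z z' _ _ hz hz' =>
    obtain ⟨a, ha, haz⟩ := hz
    obtain ⟨b, hb, hbz⟩ := hz'
    exact ⟨a + b, add_mem ha hb, by rw [add_mul, haz, hbz, add_mul]⟩
  | neg z _ hz =>
    obtain ⟨a, ha, haz⟩ := hz
    refine ⟨-a, neg_mem ha, AddMonoidHom.ext fun y => ?_⟩
    exact congrArg Neg.neg (DFunLike.congr_fun haz y)

section KernelIdeals

variable {n : ℕ} {γ : Fq[X] →+* k} {r : ℕ} (φ : DrinfeldModule p m Fq k hFq γ r)

/-- Every ideal of `A[π] = End_k(φ)` is a kernel ideal. -/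
theorem mem_of_mem_leftSpan (hk : Fintype.card k = 𝔮 ^ n)
    (hE : EndRing p m Fq k hFq φ = ApirOp p m Fq k hFq n φ) {I : Set 𝓔}
    (hI : IsIdealOf k (EndRing p m Fq k hFq φ) I) {x : 𝓔}
    (hx : x ∈ leftSpan p m Fq k hFq I) (hxE : x ∈ EndRing p m Fq k hFq φ) : x ∈ I := by
  let _ := zAlgebra hFq hk γ
  have := zAlgebra_finite (hFq := hFq) hk γ
  obtain ⟨E, _, _, _, ι, pb, hι, hmem, hsat, -⟩ := exists_endRing_model φ hk hE
  obtain ⟨hI1, hI0, hIadd, hIneg, hImul, -⟩ := hI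
  let J : Ideal E :=
    { carrier := {e | (ι e : 𝓔) ∈ I}
      add_mem' := fun {a b} ha hb => by
        simp only [Set.mem_ofPred_eq, map_add, Subring.coe_add]
        exact hIadd _ ha _ hb
      zero_mem' := by simpa using hI0
      smul_mem' := fun a b hb => by
        simp only [Set.mem_ofPred_eq, smul_eq_mul, map_mul, Subring.coe_mul]
        exact hImul _ ((hmem _).2 ⟨a, rfl⟩) _ hb }
  obtain ⟨e, rfl⟩ := (hmem x).1 hxE
  refine mem_ideal_of_mem_closure pb ι hι hsat J e ?_
  have hle : leftSpan p m Fq k hFq I ≤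
      (AddSubgroup.closure {y : 𝓡 | ∃ w : 𝓡, ∃ j ∈ J, y = w * ι j}).map
        (𝓡).subtype.toAddMonoidHom := by
    refine (AddSubgroup.closure_le _).2 ?_
    rintro _ ⟨w, hw, y, hy, rfl⟩
    obtain ⟨j, rfl⟩ := (hmem y).1 (hI1 hy)
    exact ⟨⟨w, hw⟩ * ι j, AddSubgroup.subset_closure ⟨⟨w, hw⟩, j, hy, rfl⟩, rfl⟩
  obtain ⟨y, hy, hy'⟩ := hle hx
  rwa [← Subtype.ext hy' (p := (· ∈ 𝓡))]

theorem exists_eq_ml_mul_of_isIdealGen (hk : Fintype.card k = 𝔮 ^ n)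
    (hE : EndRing p m Fq k hFq φ = ApirOp p m Fq k hFq n φ) {w : 𝓔} (hw : w ∈ 𝓡)
    (hw0 : cf w 0 ≠ 0)
    (hst : ∀ e ∈ EndRing p m Fq k hFq φ, ∀ x, w x = 0 → w (e x) = 0) {u : 𝓔}
    (hu : IsIdealGen p m Fq k hFq {x | x ∈ EndRing p m Fq k hFq φ ∧ ∃ v ∈ 𝓡, x = v * w} u) :
    ∃ c : k, c ≠ 0 ∧ u = ml k c * w := by
  obtain ⟨N, hN, v, hv, hvw⟩ := exists_frob_pow_sub_one_eq hk hw hw0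
  have hnN : n * N ≠ 0 := mul_ne_zero (card_base_pos hk) hN
  obtain ⟨S, hS, hScard⟩ := exists_finset_ker_tau_pow_sub_one (hFq := hFq) (k := k) hnN
  obtain ⟨hzR, hz0, hzdeg, -⟩ := skew_tau_pow_sub_one (hFq := hFq) (k := k) hnN
  have hcard : S.card = 𝔮 ^ deg (τ ^ (n * N) - 1) := by rw [hScard, hzdeg]
  set I : Set 𝓔 := {x | x ∈ EndRing p m Fq k hFq φ ∧ ∃ v ∈ 𝓡, x = v * w} with hIdef
  have hzE : τ ^ (n * N) - 1 ∈ EndRing p m Fq k hFq φ :=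
    sub_mem (φ.frob_mem_endRing hk N) (one_mem _)
  have hmemspan : ∀ x, x ∈ leftSpan p m Fq k hFq I ↔ ∃ a ∈ 𝓡, x = a * u := fun x =>
    Set.ext_iff.1 hu.2 x
  obtain ⟨v', hv', hv'u⟩ := (hmemspan _).1 (subset_leftSpan I ⟨hzE, v, hv, hvw⟩)
  have hspan : ∀ x ∈ leftSpan p m Fq k hFq I, ∃ a ∈ 𝓡, x = a * w := by
    intro x hx
    have h := exists_mul_eq_of_mem_leftSpan (I := I) (x := 1) (v := w)
      (fun i ⟨_, b, hb, h⟩ => ⟨b, hb, by rw [mul_one, h]⟩) hx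
    rwa [mul_one] at h
  obtain ⟨a, ha, hau⟩ := hspan u ((hmemspan u).2 ⟨1, one_mem _, (one_mul u).symm⟩)
  have hw0' : w ≠ 0 := by
    rintro rfl
    rw [skewCoeff_zero] at hw0
    exact hw0 rfl
  suffices hker : ∀ x, u x = 0 → w x = 0 by
    obtain ⟨b, hb, hbw⟩ := exists_eq_mul_of_ker_le hu.1 hv' hz0 hv'u S hS hcard hw hker
    exact exists_eq_ml_mul hw ha hb hw0' hau hbw
  intro x₀ hx₀
  let _ := zAlgebra hFq hk γ
  obtain ⟨E, _, _, _, ι, pb, hι, hmem, hsat, hdim⟩ := exists_endRing_model φ hk hE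
  let _ : Algebra Fq E := ((algebraMap Fq[X] E).comp C).toAlgebra
  have : IsScalarTower Fq Fq[X] E := IsScalarTower.of_algebraMap_eq fun _ => rfl
  let _ : Module E (Kb k) := Module.compHom (Kb k) ((𝓡).subtype.comp ι.toRingHom)
  let _ : Module Fq (Kb k) := Module.compHom (Kb k) ((algebraMap k (Kb k)).comp (γ.comp C))
  have hsmul : ∀ (e : E) (x : Kb k), e • x = (ι e : 𝓔) x := fun _ _ => rfl
  have : IsScalarTower Fq E (Kb k) := by
    refine ⟨fun c e x => ?_⟩
    rw [Algebra.smul_def, mul_smul]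
    have : (ι (algebraMap Fq E c) : 𝓔) = ml k (γ (C c)) := by
      have h1 : ι (algebraMap Fq[X] E (C c)) = algebraMap Fq[X] 𝓡 (C c) := ι.commutes _
      exact (congrArg Subtype.val h1).trans (zHom_C c)
    rw [hsmul, this]
    rfl
  have hζ : (ι (algebraMap Fq[X] E (X ^ N - 1)) : 𝓔) = τ ^ (n * N) - 1 := by
    rw [ι.commutes, map_sub, map_one, map_pow, pow_mul]
    have : (algebraMap Fq[X] 𝓡 X : 𝓔) = τ ^ n := zHom_X
    rw [AddSubgroupClass.coe_sub, Subring.coe_pow, this]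
    rfl
  let V : Submodule E (Kb k) :=
    { carrier := {x | (τ ^ (n * N) - 1) x = 0}
      add_mem' := fun {a b} ha hb => by
        simp only [Set.mem_ofPred_eq] at ha hb ⊢
        rw [map_add, ha, hb, add_zero]
      zero_mem' := map_zero _
      smul_mem' := fun e x hx => by
        simp only [Set.mem_ofPred_eq] at hx ⊢
        rw [hsmul, ← hζ, ← end_mul_apply, ← Subring.coe_mul, ← map_mul, mul_comm, map_mul,
          Subring.coe_mul, end_mul_apply, hζ, hx, map_zero] }
  have hV : ∀ x, x ∈ V ↔ (τ ^ (n * N) - 1) x = 0 := fun _ => Iff.rfl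
  have hVfin : Finite V := by
    refine Set.Finite.to_subtype (S.finite_toSet.subset fun x hx => (hS x).2 hx)
  have hVcard : Nat.card V = 𝔮 ^ (n * N) := by
    rw [← hScard, ← Nat.card_eq_finsetCard]
    exact Nat.card_congr (Equiv.subtypeEquivRight fun x => ((hS x).trans (hV x).symm).symm)
  have hfd : FiniteDimensional Fq V := Module.Finite.of_finite
  have hVrank : Module.finrank Fq V = n * N := by
    have := Fintype.ofFinite V
    refine Nat.pow_right_injective (Nat.succ_le_of_lt (Fintype.one_lt_card (α := Fq))) ?_
    change 𝔮 ^ Module.finrank Fq V = 𝔮 ^ (n * N)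
    rw [← hVcard, Nat.card_eq_fintype_card]
    exact (Module.card_eq_pow_finrank (K := Fq) (V := V)).symm
  let G : Submodule E V :=
    { carrier := {x | w x = 0}
      add_mem' := fun {a b} ha hb => by
        simp only [Set.mem_ofPred_eq] at ha hb ⊢
        rw [Submodule.coe_add, map_add, ha, hb, add_zero]
      zero_mem' := map_zero _
      smul_mem' := fun e x hx => by
        simp only [Set.mem_ofPred_eq] at hx ⊢
        exact hst _ ((hmem _).2 ⟨e, rfl⟩) _ hx }
  have hx₀V : x₀ ∈ V := by rw [hV, hv'u, end_mul_apply, hx₀, map_zero]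
  suffices h : (⟨x₀, hx₀V⟩ : V) ∈ G from h
  have hzm : (X ^ N - 1 : Fq[X]).Monic := by
    simpa using monic_X_pow_sub_C (1 : Fq) hN
  have hzd : (X ^ N - 1 : Fq[X]).natDegree = N := by
    simpa using natDegree_X_pow_sub_C (n := N) (r := (1 : Fq))
  refine mem_of_annihilator_le_of_powerBasis (F := Fq) pb (X ^ N - 1) hzm ?_ ?_ G _ ?_
  · intro e
    constructor
    · intro he
      obtain ⟨b, hb, hbe⟩ := exists_eq_mul_of_ker_le (u := τ ^ (n * N) - 1) hzR (one_mem _) hz0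
        (one_mul _).symm S hS hcard (ι e).2 fun x hx => congrArg Subtype.val (he ⟨x, hx⟩)
      have h1 : (X ^ N - 1 : Fq[X]) • (⟨b, hb⟩ : 𝓡) = ι e := by
        rw [Algebra.smul_def, Algebra.commutes, ← ι.commutes]
        exact Subtype.ext (by rw [Subring.coe_mul, hζ, hbe])
      obtain ⟨e', he'⟩ := hsat _ _ hzm.ne_zero ⟨e, h1.symm⟩
      refine ⟨e', hι ?_⟩
      rw [← h1, ← he', ← map_smul, Algebra.smul_def]
    · rintro ⟨e', rfl⟩ x
      refine Subtype.ext ?_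
      rw [mul_comm, mul_smul]
      change (ι e' : 𝓔) ((ι (algebraMap Fq[X] E (X ^ N - 1)) : 𝓔) x) = 0
      rw [hζ, (hV _).1 x.2, map_zero]
  · rw [hVrank, hzd]
    exact Nat.mul_le_mul_right _ hdim
  · intro e he
    refine Subtype.ext ?_
    change (ι e : 𝓔) x₀ = 0
    obtain ⟨b, hb, hbe⟩ := exists_eq_mul_of_ker_le hw hv hz0 hvw S hS hcard (ι e).2
      fun x hx => by
        have hxV : x ∈ V := by rw [hV, hvw, end_mul_apply, hx, map_zero]
        exact congrArg Subtype.val (he ⟨x, hxV⟩ hx)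
    obtain ⟨b', hb', hbe'⟩ := (hmemspan (ι e)).1
      (subset_leftSpan I ⟨(hmem _).2 ⟨e, rfl⟩, b, hb, hbe⟩)
    rw [hbe', end_mul_apply, hx₀, map_zero]

end KernelIdeals

section Quotients

variable {n : ℕ} {γ : Fq[X] →+* k} {r : ℕ} (φ : DrinfeldModule p m Fq k hFq γ r)

theorem skewCoeff_zero_pow_skewOrd {u x y : 𝓔} (hu : u ∈ 𝓡) (hx : x ∈ 𝓡) (hy : y ∈ 𝓡)
    (hu0 : u ≠ 0) (h : u * x = y * u) : cf x 0 ^ 𝔮 ^ ord u = cf y 0 := by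
  have h1 : cf (u * x) (ord u + 0) = cf u (ord u) * cf x 0 ^ 𝔮 ^ ord u :=
    skewCoeff_mul_eq hu hx fun i j hi _ hij => by
      have := skewOrd_le hi
      omega
  have h2 : cf (y * u) (0 + ord u) = cf y 0 * cf u (ord u) ^ 𝔮 ^ 0 :=
    skewCoeff_mul_eq hy hu fun i j _ hj hij => by
      have := skewOrd_le hj
      omega
  rw [h, add_zero] at h1
  rw [zero_add, h1, pow_zero, pow_one, mul_comm] at h2
  exact mul_right_cancel₀ (skewCoeff_skewOrd_ne_zero hu hu0) h2

theorem gamma_pow_skewOrd {ψ : DrinfeldModule p m Fq k hFq γ r} {u : 𝓔} (hu : u ∈ 𝓡)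
    (hu0 : u ≠ 0) (h : ∀ a, u * φ.toRingHom a = ψ.toRingHom a * u) (a : Fq[X]) :
    γ a ^ 𝔮 ^ ord u = γ a := by
  have := skewCoeff_zero_pow_skewOrd hu (φ.mem a) (ψ.mem a) hu0 (h a)
  rwa [φ.skewCoeff_eq, ψ.skewCoeff_eq, φ.coeff_zero, ψ.coeff_zero] at this

/-- The Drinfeld module `u φ u⁻¹`. -/
theorem exists_conj {u : 𝓔} (hu : u ∈ 𝓡) (hu0 : u ≠ 0)
    (h : ∀ a, ∃ b ∈ 𝓡, u * φ.toRingHom a = b * u) (hγ : ∀ a, γ a ^ 𝔮 ^ ord u = γ a) :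
    ∃ ψ : DrinfeldModule p m Fq k hFq γ r, ∀ a, u * φ.toRingHom a = ψ.toRingHom a * u := by
  choose f hf hfu using h
  have hdeg : ∀ a, a ≠ 0 → f a ≠ 0 ∧ deg (f a) = r * a.natDegree := by
    intro a ha
    have h0 : f a ≠ 0 := by
      intro h0
      have := hfu a
      rw [h0, zero_mul] at this
      exact skew_mul_ne_zero hu (φ.mem a) hu0 (φ.ne_zero ha) this
    refine ⟨h0, ?_⟩
    have h1 := skewDeg_mul hu (φ.mem a) hu0 (φ.ne_zero ha)
    rw [hfu a, skewDeg_mul (hf a) hu h0 hu0, φ.skewDeg_eq ha] at h1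
    omega
  refine ⟨⟨⟨⟨⟨f, ?_⟩, ?_⟩, ?_, ?_⟩, fun a => cf (f a), fun a => (ofCoeffs_skewCoeff (hf a)).symm,
    fun a => ?_, fun a ha => ?_, fun a i hi => ?_⟩, hfu⟩
  · refine skew_mul_right_cancel hu (hf 1) (one_mem _) hu0 ?_
    rw [← hfu, map_one, mul_one, one_mul]
  · intro a b
    refine skew_mul_right_cancel hu (hf _) (mul_mem (hf a) (hf b)) hu0 ?_
    rw [← hfu, map_mul, ← mul_assoc, hfu, mul_assoc, hfu, mul_assoc]
  · refine skew_mul_right_cancel hu (hf 0) (zero_mem _) hu0 ?_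
    change f 0 * u = 0 * u
    rw [← hfu, map_zero, mul_zero, zero_mul]
  · intro a b
    refine skew_mul_right_cancel hu (hf _) (add_mem (hf a) (hf b)) hu0 ?_
    change f (a + b) * u = (f a + f b) * u
    rw [← hfu, map_add, mul_add, hfu, hfu, add_mul]
  · rw [← skewCoeff_zero_pow_skewOrd hu (φ.mem a) (hf a) hu0 (hfu a), φ.skewCoeff_eq,
      φ.coeff_zero, hγ]
  · obtain ⟨h0, h1⟩ := hdeg a ha
    rw [← h1]
    exact skewCoeff_skewDeg_ne_zero (hf a) h0
  · by_cases ha : a = 0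
    · have h0 : f a = 0 := by
        refine skew_mul_right_cancel hu (hf a) (zero_mem _) hu0 ?_
        rw [← hfu, ha, map_zero, mul_zero, zero_mul]
      rw [h0, skewCoeff_zero]
      rfl
    · rw [← (hdeg a ha).2] at hi
      exact skewCoeff_eq_zero_of_skewDeg_lt hi

theorem exists_skewOrd_eq {I : Set 𝓔} (hI : I ⊆ 𝓡) {u : 𝓔} (hu0 : u ≠ 0)
    (hu : IsIdealGen p m Fq k hFq I u) : ∃ x ∈ I, x ≠ 0 ∧ ord x = ord u := by
  have hmem : ∀ x, x ∈ leftSpan p m Fq k hFq I ↔ ∃ a ∈ 𝓡, x = a * u := fun x =>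
    Set.ext_iff.1 hu.2 x
  have hlt : ∀ x ∈ I, ∀ j < ord u, cf x j = 0 := by
    intro x hx j hj
    obtain ⟨a, ha, rfl⟩ := (hmem x).1 (subset_leftSpan I hx)
    refine skewCoeff_mul_eq_zero ha hu.1 fun i j' _ hj' hij => ?_
    have := skewOrd_le hj'
    omega
  by_contra! hcon
  have hle : ∀ x ∈ I, ∀ j, cf x j ≠ 0 → ord u + 1 ≤ j := by
    intro x hx j hj
    by_contra hlt'
    rcases (Nat.lt_succ_iff.1 (not_le.1 hlt')).lt_or_eq with h | h
    · exact hj (hlt x hx j h)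
    · refine hcon x hx ?_ (skewOrd_eq (h ▸ hj) (hlt x hx))
      rintro rfl
      rw [skewCoeff_zero] at hj
      exact hj rfl
  have hspan : ∃ b ∈ 𝓡, u * 1 = b * τ ^ (ord u + 1) := by
    refine exists_mul_eq_of_mem_leftSpan (fun i hi => ?_)
      ((hmem u).2 ⟨1, one_mem _, (one_mul u).symm⟩)
    rw [mul_one]
    refine exists_eq_mul_tau_pow (hI hi) _ fun j hj => ?_
    by_contra h
    exact absurd (hle i hi j h) (by omega)
  obtain ⟨b, hb, h⟩ := hspan
  rw [mul_one] at h
  have hb0 : b ≠ 0 := by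
    rintro rfl
    rw [zero_mul] at h
    exact hu0 h
  have := skewOrd_mul hb (pow_mem tau_mem (ord u + 1)) hb0 (tau_pow_ne_zero (hFq := hFq) _)
  rw [← h, skewOrd_tau_pow] at this
  omega

/-- Existence of `I * φ`. -/
theorem exists_idealGen_isogeny {I : Set 𝓔} (hI : IsIdealOf k (EndRing p m Fq k hFq φ) I)
    (hI0 : I ≠ {0}) : ∃ (ψ : DrinfeldModule p m Fq k hFq γ r) (u : 𝓔),
      IsIdealGen p m Fq k hFq I u ∧ IsIsogeny p m Fq k hFq φ ψ u := by
  obtain ⟨hIE, hzero, -, -, -, hmul⟩ := hI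
  have hIR : I ⊆ 𝓡 := fun x hx => (hIE hx).1
  have hne : ∃ x ∈ I, x ≠ 0 := by
    by_contra! h
    exact hI0 (Set.eq_singleton_iff_unique_mem.2 ⟨hzero, h⟩)
  obtain ⟨u, hu0, hu⟩ := exists_isIdealGen hIR hne
  have hmem : ∀ x, x ∈ leftSpan p m Fq k hFq I ↔ ∃ a ∈ 𝓡, x = a * u := fun x =>
    Set.ext_iff.1 hu.2 x
  obtain ⟨x, hx, hx0, hord⟩ := exists_skewOrd_eq hIR hu0 hu
  obtain ⟨ψ, hψ⟩ := exists_conj φ hu.1 hu0 (fun a => by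
    refine exists_mul_eq_of_mem_leftSpan (fun i hi => ?_)
      ((hmem u).2 ⟨1, one_mem _, (one_mul u).symm⟩)
    exact (hmem _).1 (subset_leftSpan I (hmul _ (φ.mem_endRing a) i hi))) fun a => by
    rw [← hord]
    exact gamma_pow_skewOrd φ (hIR hx) hx0
      (fun b => (Subring.mem_centralizer_iff.1 (hIE hx).2 _ ⟨b, rfl⟩).symm) a
  exact ⟨ψ, u, hu, hu0, hu.1, hψ⟩

end Quotients

section Classes

variable {n : ℕ} {γ : Fq[X] →+* k} {r : ℕ} {φ : DrinfeldModule p m Fq k hFq γ r}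

theorem isomorphic_of_eq_ml_mul {ψ ψ' : DrinfeldModule p m Fq k hFq γ r} {u u' : 𝓔}
    (hu : u ∈ 𝓡) (hu0 : u ≠ 0) (h : ∀ a, u * φ.toRingHom a = ψ.toRingHom a * u)
    (h' : ∀ a, u' * φ.toRingHom a = ψ'.toRingHom a * u') {c : k} (hc : c ≠ 0)
    (huc : u' = ml k c * u) : Isomorphic p m Fq k hFq ψ ψ' := by
  refine ⟨c, hc, fun a => skew_mul_right_cancel hu (mul_mem (ml_mem c) (ψ.mem a))
    (mul_mem (ψ'.mem a) (ml_mem c)) hu0 ?_⟩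
  rw [mul_assoc, ← h, ← mul_assoc, ← huc, h', mul_assoc, ← huc]

theorem endRing_mul_comm (hk : Fintype.card k = 𝔮 ^ n)
    (hE : EndRing p m Fq k hFq φ = ApirOp p m Fq k hFq n φ) {x y : 𝓔}
    (hx : x ∈ EndRing p m Fq k hFq φ) (hy : y ∈ EndRing p m Fq k hFq φ) : x * y = y * x := by
  let _ := zAlgebra hFq hk γ
  obtain ⟨E, _, _, _, ι, -, -, hmem, -⟩ := exists_endRing_model φ hk hE
  obtain ⟨e, rfl⟩ := (hmem x).1 hx
  obtain ⟨e', rfl⟩ := (hmem y).1 hy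
  rw [← Subring.coe_mul, ← Subring.coe_mul, ← map_mul, ← map_mul, mul_comm]

theorem image_mul_subset (hk : Fintype.card k = 𝔮 ^ n)
    (hE : EndRing p m Fq k hFq φ = ApirOp p m Fq k hFq n φ) {I J : Set 𝓔}
    (hI : IsIdealOf k (EndRing p m Fq k hFq φ) I) (hJ : IsIdealOf k (EndRing p m Fq k hFq φ) J)
    {u v x y b : 𝓔} (hx : x ∈ EndRing p m Fq k hFq φ) (hy : y ∈ EndRing p m Fq k hFq φ)
    (hu : IsIdealGen p m Fq k hFq I u) (hv : IsIdealGen p m Fq k hFq J v) (hb : b ∈ 𝓡)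
    (h : u * x = b * (v * y)) : (fun i => i * x) '' I ⊆ (fun j => j * y) '' J := by
  rintro _ ⟨i, hi, rfl⟩
  have hJy : IsIdealOf k (EndRing p m Fq k hFq φ) ((fun j => j * y) '' J) := by
    obtain ⟨h1, h2, h3, h4, h5, h6⟩ := hJ
    refine ⟨?_, ⟨0, h2, zero_mul y⟩, ?_, ?_, ?_, ?_⟩
    · rintro _ ⟨j, hj, rfl⟩
      exact mul_mem (h1 hj) hy
    · rintro _ ⟨j, hj, rfl⟩ _ ⟨j', hj', rfl⟩
      exact ⟨j + j', h3 j hj j' hj', add_mul _ _ _⟩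
    · rintro _ ⟨j, hj, rfl⟩
      exact ⟨-j, h4 j hj, AddMonoidHom.ext fun _ => rfl⟩
    · rintro e he _ ⟨j, hj, rfl⟩
      exact ⟨e * j, h5 e he j hj, mul_assoc _ _ _⟩
    · rintro e he _ ⟨j, hj, rfl⟩
      refine ⟨j * e, h6 e he j hj, ?_⟩
      change j * e * y = j * y * e
      rw [mul_assoc, mul_assoc, endRing_mul_comm hk hE he hy]
  refine mem_of_mem_leftSpan φ hk hE hJy ?_ (mul_mem (hI.1 hi) hx)
  obtain ⟨a, ha, rfl⟩ : ∃ a ∈ 𝓡, i = a * u := (Set.ext_iff.1 hu.2 i).1 (subset_leftSpan I hi)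
  have hvJ : v ∈ leftSpan p m Fq k hFq J :=
    (Set.ext_iff.1 hv.2 v).2 ⟨1, one_mem _, (one_mul v).symm⟩
  have hvy : v * y ∈ leftSpan p m Fq k hFq ((fun j => j * y) '' J) := by
    have hle : leftSpan p m Fq k hFq J ≤
        (leftSpan p m Fq k hFq ((fun j => j * y) '' J)).comap (AddMonoidHom.mulRight y) := by
      refine (AddSubgroup.closure_le _).2 ?_
      rintro _ ⟨w, hw, j, hj, rfl⟩
      exact AddSubgroup.subset_closure ⟨w, hw, j * y, ⟨j, hj, rfl⟩, mul_assoc _ _ _⟩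
    exact hle hvJ
  change a * u * x ∈ _
  rw [mul_assoc, h, ← mul_assoc]
  exact mul_mem_leftSpan (mul_mem ha hb) hvy

theorem exists_mul_eq_of_image_subset {I J : Set 𝓔} {u v x y : 𝓔}
    (hu : IsIdealGen p m Fq k hFq I u) (hv : IsIdealGen p m Fq k hFq J v)
    (h : (fun i => i * x) '' I ⊆ (fun j => j * y) '' J) : ∃ b ∈ 𝓡, u * x = b * (v * y) := by
  refine exists_mul_eq_of_mem_leftSpan (fun i hi => ?_)
    ((Set.ext_iff.1 hu.2 u).2 ⟨1, one_mem _, (one_mul u).symm⟩)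
  obtain ⟨j, hj, hij⟩ := h ⟨i, hi, rfl⟩
  obtain ⟨a, ha, rfl⟩ : ∃ a ∈ 𝓡, j = a * v := (Set.ext_iff.1 hv.2 j).1 (subset_leftSpan J hj)
  exact ⟨a, ha, by rw [← mul_assoc]; exact hij.symm⟩

theorem exists_dual {ψ : DrinfeldModule p m Fq k hFq γ r} {u : 𝓔}
    (hu : IsIsogeny p m Fq k hFq φ ψ u) : ∃ a ≠ 0, ∃ v ∈ 𝓡, v ≠ 0 ∧ v * u = φ.toRingHom a ∧
      u * v = ψ.toRingHom a ∧ ∀ b, v * ψ.toRingHom b = φ.toRingHom b * v := by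
  obtain ⟨hu0, huR, hiso⟩ := hu
  obtain ⟨i, j, hij, v, hv, h⟩ := exists_sub_eq_mul huR hu0 (fun i => φ.toRingHom (X ^ i))
    fun i => φ.mem _
  have hvu : v * u = φ.toRingHom (X ^ j - X ^ i) := by rw [map_sub]; exact h.symm
  have ha0 : (X ^ j - X ^ i : Fq[X]) ≠ 0 := by
    intro h0
    have := congrArg natDegree (sub_eq_zero.1 h0)
    rw [natDegree_X_pow, natDegree_X_pow] at this
    omega
  refine ⟨X ^ j - X ^ i, ha0, v, hv, ?_, hvu, ?_, fun b => ?_⟩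
  · rintro rfl
    rw [zero_mul] at hvu
    exact φ.ne_zero ha0 hvu.symm
  · refine skew_mul_right_cancel huR (mul_mem huR hv) (ψ.mem _) hu0 ?_
    rw [mul_assoc, hvu, hiso]
  · refine skew_mul_right_cancel huR (mul_mem hv (ψ.mem b)) (mul_mem (φ.mem b) hv) hu0 ?_
    rw [mul_assoc, ← hiso, ← mul_assoc, hvu, mul_assoc, hvu, φ.comm]

theorem linEquiv_iff (hk : Fintype.card k = 𝔮 ^ n)
    (hE : EndRing p m Fq k hFq φ = ApirOp p m Fq k hFq n φ) {I J : Set 𝓔}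
    (hI : IsIdealOf k (EndRing p m Fq k hFq φ) I) (hJ : IsIdealOf k (EndRing p m Fq k hFq φ) J)
    {ψ ψ' : DrinfeldModule p m Fq k hFq γ r} {u v : 𝓔}
    (hu : IsIdealGen p m Fq k hFq I u) (hv : IsIdealGen p m Fq k hFq J v)
    (hψ : IsIsogeny p m Fq k hFq φ ψ u) (hψ' : IsIsogeny p m Fq k hFq φ ψ' v) :
    LinEquiv p m Fq k hFq φ (EndRing p m Fq k hFq φ) I J ↔ Isomorphic p m Fq k hFq ψ ψ' := by
  constructor
  · rintro ⟨e, he, he0, a, ha, h⟩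
    obtain ⟨b, hb, hb'⟩ := exists_mul_eq_of_image_subset hu hv h.subset
    obtain ⟨b', hb1, hb1'⟩ := exists_mul_eq_of_image_subset hv hu h.symm.subset
    have hua0 := skew_mul_ne_zero hu.1 (φ.mem a) hψ.1 (φ.ne_zero ha)
    obtain ⟨c, hc, hcu⟩ := exists_eq_ml_mul (mul_mem hu.1 (φ.mem a)) hb1 hb hua0 hb1' hb'
    refine isomorphic_of_eq_ml_mul (φ := φ) (mul_mem hu.1 (φ.mem a)) hua0 (fun b => ?_) (fun b => ?_) hc hcu
    · rw [mul_assoc, φ.comm, ← mul_assoc, hψ.2.2, mul_assoc]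
    · rw [mul_assoc, ← Subring.mem_centralizer_iff.1 he.2 _ ⟨b, rfl⟩, ← mul_assoc, hψ'.2.2,
        mul_assoc]
  · rintro ⟨c, hc, hiso⟩
    obtain ⟨a, ha, w, hw, hw0, hwv, hvw, hwψ⟩ := exists_dual hψ'
    have hml0 : ml k c ≠ 0 := by
      intro h
      have := skewCoeff_ml (hFq := hFq) c
      rw [h, skewCoeff_zero] at this
      exact hc (by simpa using (DFunLike.congr_fun this 0).symm)
    have hcu := mul_mem (ml_mem (hFq := hFq) c) hu.1
    have heE : w * (ml k c * u) ∈ EndRing p m Fq k hFq φ := by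
      refine ⟨mul_mem hw hcu, Subring.mem_centralizer_iff.2 ?_⟩
      rintro _ ⟨b, rfl⟩
      rw [← mul_assoc, ← hwψ, mul_assoc, ← mul_assoc _ _ u, ← hiso, mul_assoc _ _ u, ← hψ.2.2]
      simp only [mul_assoc]
    have hkey : v * (w * (ml k c * u)) = ml k c * (u * φ.toRingHom a) := by
      rw [← mul_assoc, hvw, ← mul_assoc, ← hiso, mul_assoc, ← hψ.2.2]
    refine ⟨w * (ml k c * u), heE, ?_, a, ha, Set.Subset.antisymm ?_ ?_⟩
    · exact skew_mul_ne_zero hw hcu hw0 (skew_mul_ne_zero (ml_mem c) hu.1 hml0 hψ.1)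
    · refine image_mul_subset hk hE hI hJ (φ.mem_endRing a) heE hu hv (ml_mem c⁻¹) ?_
      rw [hkey, ← mul_assoc, ml_inv_mul_ml hc, one_mul]
    · exact image_mul_subset hk hE hJ hI heE (φ.mem_endRing a) hv hu (ml_mem c) hkey

end Classes

section Surjectivity

variable {n : ℕ} {γ : Fq[X] →+* k} {r : ℕ} {φ : DrinfeldModule p m Fq k hFq γ r}

theorem natDegree_dvd_of_gamma_pow {P : Fq[X]} (hP : P.Monic)
    (hker : RingHom.ker γ = Ideal.span {P}) {h : ℕ} (hγ : ∀ a, γ a ^ 𝔮 ^ h = γ a) :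
    P.natDegree ∣ h := by
  have hprime : Prime P := by
    rw [← Ideal.span_singleton_prime hP.ne_zero, ← hker]
    exact RingHom.ker_isPrime γ
  have : Fact (Irreducible P) := ⟨hprime.irreducible⟩
  have : Module.Finite Fq (AdjoinRoot P) := (AdjoinRoot.powerBasis hP.ne_zero).finite
  have : Finite (AdjoinRoot P) := Module.finite_of_finite Fq
  have := Fintype.ofFinite (AdjoinRoot P)
  have hcard : Fintype.card (AdjoinRoot P) = 𝔮 ^ P.natDegree := by
    rw [Module.card_eq_pow_finrank (K := Fq), (AdjoinRoot.powerBasis hP.ne_zero).finrank]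
    rfl
  have hq : 1 < 𝔮 := Fintype.one_lt_card
  have hpos : ∀ i, 1 ≤ 𝔮 ^ i := fun i => Nat.one_le_pow _ _ (by omega)
  have hdvd : 𝔮 ^ P.natDegree - 1 ∣ 𝔮 ^ h - 1 := by
    rw [← hcard, ← FiniteField.forall_pow_eq_one_iff]
    intro x
    refine Units.ext ?_
    rw [Units.val_pow_eq_pow_val, Units.val_one]
    refine mul_right_cancel₀ x.ne_zero ?_
    rw [← pow_succ, Nat.sub_add_cancel (hpos h), one_mul]
    obtain ⟨a, ha⟩ := AdjoinRoot.mk_surjective (x : AdjoinRoot P)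
    rw [← ha, ← map_pow, AdjoinRoot.mk_eq_mk, ← Ideal.mem_span_singleton, ← hker,
      RingHom.mem_ker, map_sub, map_pow, hγ, sub_self]
  have hgcd := Nat.gcd_eq_left hdvd
  rw [Nat.pow_sub_one_gcd_pow_sub_one] at hgcd
  have heq : 𝔮 ^ P.natDegree.gcd h = 𝔮 ^ P.natDegree := by
    have h1 := hpos (P.natDegree.gcd h)
    have h2 := hpos P.natDegree
    omega
  exact Nat.gcd_eq_left_iff_dvd.1 (Nat.pow_right_injective hq heq)

theorem skewOrd_eq_of_hasHeight {P : Fq[X]} (hP : P ≠ 0) {H : ℕ}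
    (hH : HasHeight p m Fq k hFq φ P H) : ord (φ.toRingHom P) = H * P.natDegree := by
  obtain ⟨⟨u, hu, h⟩, hnot⟩ := hH
  have hu0 : u ≠ 0 := by
    rintro rfl
    rw [zero_mul] at h
    exact φ.ne_zero hP h
  have hord := skewOrd_mul hu (pow_mem tau_mem (H * P.natDegree)) hu0
    (tau_pow_ne_zero (hFq := hFq) _)
  rw [← h, skewOrd_tau_pow] at hord
  rw [hord, Nat.add_eq_right]
  by_contra hne
  obtain ⟨v, hv, rfl⟩ := exists_eq_mul_tau_pow hu 1 fun i hi => by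
    by_contra hi'
    have := skewOrd_le hi'
    omega
  exact hnot ⟨v, hv, by rw [h, mul_assoc, ← pow_add, add_comm 1]⟩

theorem exists_isogeny_skewOrd_eq_mul (hk : Fintype.card k = 𝔮 ^ n) {P : Fq[X]} (hP : P.Monic)
    (hker : RingHom.ker γ = Ideal.span {P})
    (hcond : P.natDegree = n ∨ HasHeight p m Fq k hFq φ P 1)
    {ψ : DrinfeldModule p m Fq k hFq γ r} {u : 𝓔} (hu : IsIsogeny p m Fq k hFq φ ψ u) :
    ∃ v, IsIsogeny p m Fq k hFq φ ψ v ∧ n ∣ ord v := by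
  have hdvd : P.natDegree ∣ ord u :=
    natDegree_dvd_of_gamma_pow hP hker (gamma_pow_skewOrd φ hu.2.1 hu.1 hu.2.2)
  rcases hcond with h | h
  · exact ⟨u, hu, h ▸ hdvd⟩
  have hdvd' : P.natDegree ∣ n := natDegree_dvd_of_gamma_pow hP hker fun a => by
    simpa using pow_card_base hk (γ a) 1
  have hordP := skewOrd_eq_of_hasHeight hP.ne_zero h
  have hpow : ∀ y, ord (φ.toRingHom (P ^ y)) = y * P.natDegree := by
    intro y
    induction y with
    | zero =>
      have := skewOrd_tau_pow (k := k) (hFq := hFq) 0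
      rw [pow_zero] at this
      rw [pow_zero, map_one, this, zero_mul]
    | succ y ih =>
      rw [pow_succ, map_mul, skewOrd_mul (φ.mem _) (φ.mem _) (φ.ne_zero (pow_ne_zero _ hP.ne_zero))
        (φ.ne_zero hP.ne_zero), ih, hordP]
      ring
  obtain ⟨h', hh'⟩ := hdvd
  obtain ⟨n', hn'⟩ := hdvd'
  have hn0 : n' ≠ 0 := by
    rintro rfl
    exact card_base_pos hk hn'
  obtain ⟨l, rfl⟩ := Nat.exists_eq_succ_of_ne_zero hn0
  have hP0 := φ.ne_zero (pow_ne_zero (h' * l) hP.ne_zero)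
  refine ⟨u * φ.toRingHom (P ^ (h' * l)), ⟨skew_mul_ne_zero hu.2.1 (φ.mem _) hu.1 hP0,
    mul_mem hu.2.1 (φ.mem _), fun a => ?_⟩, h', ?_⟩
  · rw [mul_assoc, φ.comm, ← mul_assoc, hu.2.2, mul_assoc]
  · rw [skewOrd_mul hu.2.1 (φ.mem _) hu.1 hP0, hpow, hh', hn', Nat.succ_eq_add_one]
    ring

theorem exists_isogeny_skewCoeff_zero_ne_zero (hk : Fintype.card k = 𝔮 ^ n)
    {ψ : DrinfeldModule p m Fq k hFq γ r} {u : 𝓔} (hu : IsIsogeny p m Fq k hFq φ ψ u)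
    (hord : n ∣ ord u) : ∃ w, IsIsogeny p m Fq k hFq φ ψ w ∧ cf w 0 ≠ 0 := by
  obtain ⟨j, hj⟩ := hord
  obtain ⟨w, hw, hwu⟩ := exists_eq_mul_tau_pow hu.2.1 (ord u) fun i hi => by
    by_contra hi'
    have := skewOrd_le hi'
    omega
  have hw0 : w ≠ 0 := by
    rintro rfl
    rw [zero_mul] at hwu
    exact hu.1 hwu
  have hτ : τ ^ (n * j) ∈ 𝓡 := pow_mem tau_mem _
  have hτ0 : τ ^ (n * j) ≠ 0 := tau_pow_ne_zero _
  have hordw : ord w = 0 := by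
    have h := congrArg (ord) hwu
    rw [hj, skewOrd_mul hw hτ hw0 hτ0, skewOrd_tau_pow] at h
    omega
  rw [hj] at hwu
  refine ⟨w, ⟨hw0, hw, fun a => ?_⟩, ?_⟩
  · refine skew_mul_right_cancel hτ (mul_mem hw (φ.mem a)) (mul_mem (ψ.mem a) hw) hτ0 ?_
    rw [mul_assoc, ← frob_comm hk j (φ.mem a), ← mul_assoc, ← hwu, hu.2.2, hwu, mul_assoc]
  · rw [← hordw]
    exact skewCoeff_skewOrd_ne_zero hw hw0

/-- An isogeny with nonzero constant coefficient is given by a kernel ideal. -/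
theorem exists_ideal_of_isogeny (hk : Fintype.card k = 𝔮 ^ n)
    (hE : EndRing p m Fq k hFq φ = ApirOp p m Fq k hFq n φ)
    {ψ : DrinfeldModule p m Fq k hFq γ r} {w : 𝓔} (hw : IsIsogeny p m Fq k hFq φ ψ w)
    (hw0 : cf w 0 ≠ 0) : ∃ I : Set 𝓔, IsIdealOf k (EndRing p m Fq k hFq φ) I ∧ I ≠ {0} ∧
      ∀ u, IsIdealGen p m Fq k hFq I u → ∃ c : k, c ≠ 0 ∧ u = ml k c * w := by
  refine ⟨{x | x ∈ EndRing p m Fq k hFq φ ∧ ∃ v ∈ 𝓡, x = v * w}, ⟨fun x hx => hx.1,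
    ⟨zero_mem _, 0, zero_mem _, (zero_mul w).symm⟩, ?_, ?_, ?_, ?_⟩, ?_, fun u hu =>
    exists_eq_ml_mul_of_isIdealGen φ hk hE hw.2.1 hw0 ?_ hu⟩
  · rintro _ ⟨hx, a, ha, rfl⟩ _ ⟨hy, b, hb, rfl⟩
    exact ⟨add_mem hx hy, a + b, add_mem ha hb, (add_mul _ _ _).symm⟩
  · rintro _ ⟨hx, a, ha, rfl⟩
    exact ⟨neg_mem hx, -a, neg_mem ha, AddMonoidHom.ext fun _ => rfl⟩
  · rintro e he _ ⟨hx, a, ha, rfl⟩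
    exact ⟨mul_mem he hx, e * a, mul_mem he.1 ha, (mul_assoc _ _ _).symm⟩
  · rintro e he _ ⟨hx, a, ha, rfl⟩
    exact ⟨mul_mem hx he, e * a, mul_mem he.1 ha, by rw [endRing_mul_comm hk hE hx he, mul_assoc]⟩
  · obtain ⟨a, ha, v, hv, -, hvw, -⟩ := exists_dual hw
    intro h
    refine φ.ne_zero ha (Set.mem_singleton_iff.1 (h ▸ ⟨φ.mem_endRing a, v, hv, hvw.symm⟩))
  · intro e he
    rw [hE] at he
    induction he using Subring.closure_induction with
    | mem e he =>
      intro x hx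
      rw [← end_mul_apply]
      rcases he with rfl | ⟨a, rfl⟩
      · rw [← frob_comm' hk hw.2.1, end_mul_apply, hx, map_zero]
      · rw [hw.2.2, end_mul_apply, hx, map_zero]
    | zero => exact fun x _ => map_zero w
    | one => exact fun x hx => hx
    | add e e' _ _ h h' =>
      intro x hx
      rw [end_add_apply, map_add, h x hx, h' x hx, add_zero]
    | neg e _ h =>
      intro x hx
      exact (map_neg w (e x)).trans (by rw [h x hx, neg_zero])
    | mul e e' _ _ h h' => exact fun x hx => h _ (h' x hx)

end Surjectivity

end Skew

end Drinfeld

namespace Drinfeld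

/-- **Theorem B.** Assume either `k = 𝔽_𝔭` (i.e. `n = d`) or `φ` is ordinary,
and that `End_k(φ) = A[π]`.  Then `I ↦ I*φ` induces a bijection from the set of linear
equivalence classes of nonzero ideals of `A[π]` onto the set of isomorphism classes of
Drinfeld modules over `k` isogenous to `φ`: there is an assignment `S` of a Drinfeld module
`S I = I*φ` to each nonzero ideal `I` (given by a generator `u_I` of `k{τ}I`, with
`u_I φ_a = (S I)_a u_I`), such that `I, J` are linearly equivalent iff `S I ≅ S J`, and every
`ψ` isogenous to `φ` is isomorphic to some `S I`. -/
theorem statement1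
    (p m n : ℕ) [Fact p.Prime] (Fq k : Type) [Field Fq] [Fintype Fq]
    [Field k] [Fintype k] [CharP k p] (hFq : Fintype.card Fq = p ^ m)
    (hk : Fintype.card k = Fintype.card Fq ^ n)
    (γ : Polynomial Fq →+* k) (r : ℕ) (hr : 1 ≤ r)
    (P : Polynomial Fq) (hP : P.Monic) (hker : RingHom.ker γ = Ideal.span {P})
    (φ : DrinfeldModule p m Fq k hFq γ r)
    (hcond : P.natDegree = n ∨ HasHeight p m Fq k hFq φ P 1)
    (hE : EndRing p m Fq k hFq φ = ApirOp p m Fq k hFq n φ) :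
    ∃ S : {I : Set (AddMonoid.End (Kb k)) //
            IsIdealOf k (ApirOp p m Fq k hFq n φ) I ∧ I ≠ {0}} →
          DrinfeldModule p m Fq k hFq γ r,
      (∀ I, ∃ u : AddMonoid.End (Kb k), IsIdealGen p m Fq k hFq I.1 u ∧
          IsIsogeny p m Fq k hFq φ (S I) u ∧
          ∀ a, u * φ.toRingHom a = (S I).toRingHom a * u) ∧
      (∀ I J, LinEquiv p m Fq k hFq φ (ApirOp p m Fq k hFq n φ) I.1 J.1 ↔
          Isomorphic p m Fq k hFq (S I) (S J)) ∧
      (∀ ψ : DrinfeldModule p m Fq k hFq γ r,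
          (∃ u, IsIsogeny p m Fq k hFq φ ψ u) → ∃ I, Isomorphic p m Fq k hFq (S I) ψ) := by
  have hE' : ∀ I : {I : Set (AddMonoid.End (Kb k)) //
      IsIdealOf k (ApirOp p m Fq k hFq n φ) I ∧ I ≠ {0}},
      IsIdealOf k (EndRing p m Fq k hFq φ) I.1 := fun I => by
    rw [hE]
    exact I.2.1
  choose S u hu hφ using fun I : {I : Set (AddMonoid.End (Kb k)) //
      IsIdealOf k (ApirOp p m Fq k hFq n φ) I ∧ I ≠ {0}} =>
    exists_idealGen_isogeny φ (hE' I) I.2.2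
  refine ⟨S, fun I => ⟨u I, hu I, hφ I, (hφ I).2.2⟩, fun I J => ?_, ?_⟩
  · have h := linEquiv_iff hk hE (hE' I) (hE' J) (hu I) (hu J) (hφ I) (hφ J)
    rwa [hE] at h
  · rintro ψ ⟨v, hv⟩
    obtain ⟨v', hv', hord⟩ := exists_isogeny_skewOrd_eq_mul hk hP hker hcond hv
    obtain ⟨w, hw, hw0⟩ := exists_isogeny_skewCoeff_zero_ne_zero hk hv' hord
    obtain ⟨I, hI, hI0, hgen⟩ := exists_ideal_of_isogeny hk hE hw hw0
    rw [hE] at hI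
    obtain ⟨c, hc, huc⟩ := hgen _ (hu ⟨I, hI, hI0⟩)
    refine ⟨⟨I, hI, hI0⟩, isomorphic_of_eq_ml_mul (hφ _).2.1 (hφ _).1 (hφ _).2.2 hw.2.2
      (inv_ne_zero hc) ?_⟩
    rw [huc, ← mul_assoc, ml_inv_mul_ml hc, one_mul]

end Drinfeld
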